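/- Let n ≥ 2, let Ω ⊂ ℝⁿ be open, let p ∈ (n−1, n), and let σ : [0,∞) → [0,∞) be a continuous function with ∫^∞ dt/(t σ(t)) = ∞. Then every weakly monotone function u ∈ W^{1,p}_loc(Ω) admits a representative whose restriction to the complement in Ω of a set of C_{Ψ,1}-capacity zero is continuous, where Ψ(t) = σ(t) t^p. In particular, this holds with σ(t) = log(1+t). -/

import Mathlib

open MeasureTheory Metric Set Filter ENNReal
open scoped Topology NNReal

noncomputable section

/-- Euclidean space `ℝⁿ`. -/
abbrev Euc (n : ℕ) : Type := EuclideanSpace ℝ (Fin n)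

/-- A Young function: a convex function `A : [0,∞) → [0,∞]` with `A 0 = 0`,
not constant on `(0,∞)`.  (Only values on `[0,∞)` are relevant.) -/
def IsYoung (A : ℝ → ℝ≥0∞) : Prop :=
  A 0 = 0 ∧
    (∀ ⦃x y : ℝ⦄, 0 ≤ x → 0 ≤ y → ∀ ⦃l : ℝ⦄, 0 ≤ l → l ≤ 1 →
      A (l * x + (1 - l) * y) ≤ ENNReal.ofReal l * A x + ENNReal.ofReal (1 - l) * A y) ∧
    ∃ x y : ℝ, 0 < x ∧ 0 < y ∧ A x ≠ A y

/-- The Young conjugate `Ã(t) = sup { s·t − A(s) : s ≥ 0 }`. -/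
def youngConj (A : ℝ → ℝ≥0∞) (t : ℝ) : ℝ≥0∞ :=
  ⨆ s : Ici (0 : ℝ), (ENNReal.ofReal ((s : ℝ) * t) - A s)

/-- The exponent `(n-1)/(n-2)`. -/
def youngExp (n : ℕ) : ℝ := ((n : ℝ) - 1) / ((n : ℝ) - 2)

/-- The Young function `A_{n-1}`; equal to `A` for `n = 2`, and for `n ≥ 3` the
Young conjugate of `t ↦ t^{(n-1)/(n-2)} ∫_t^∞ Ã(r) r^{-1-(n-1)/(n-2)} dr`. -/
def youngShifted (n : ℕ) (A : ℝ → ℝ≥0∞) : ℝ → ℝ≥0∞ :=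
  if n = 2 then A
  else youngConj fun t =>
    ENNReal.ofReal (t ^ youngExp n) *
      ∫⁻ r in Ioi t, youngConj A r / ENNReal.ofReal (r ^ (1 + youngExp n))

/-- The generalized right-continuous inverse of a Young function. -/
def youngInv (A : ℝ → ℝ≥0∞) (τ : ℝ≥0∞) : ℝ≥0∞ :=
  ⨅ (s : ℝ) (_ : 0 ≤ s ∧ τ < A s), ENNReal.ofReal s

/-- The condition `∫^∞ (t/A(t))^{1/(n-2)} dt < ∞`. -/
def TailCondition (n : ℕ) (A : ℝ → ℝ≥0∞) : Prop :=
  ∃ t₀ : ℝ, 0 < t₀ ∧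
    ∫⁻ t in Ioi t₀, (ENNReal.ofReal t / A t) ^ (1 / ((n : ℝ) - 2)) < ∞

/-- The Δ₂-condition near infinity. -/
def Delta2Infty (A : ℝ → ℝ≥0∞) : Prop :=
  ∃ C : ℝ, 2 < C ∧ ∃ t₀ : ℝ, 0 ≤ t₀ ∧ ∀ t : ℝ, t₀ ≤ t → A (2 * t) ≤ ENNReal.ofReal C * A t

/-- `g` is the weak gradient of `u` on the open set `Ω`, with `u` and `g`
locally integrable on `Ω`. -/
def IsWeakGradOn {n : ℕ} (Ω : Set (Euc n)) (u : Euc n → ℝ) (g : Euc n → Euc n) : Prop :=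
  LocallyIntegrableOn u Ω volume ∧ LocallyIntegrableOn (fun x => ‖g x‖) Ω volume ∧
    ∀ φ : Euc n → ℝ, ContDiff ℝ (⊤ : ℕ∞) φ → HasCompactSupport φ → tsupport φ ⊆ Ω →
      ∀ i : Fin n,
        ∫ x, u x * fderiv ℝ φ x (EuclideanSpace.single i 1) = - ∫ x, g x i * φ x

/-- Membership in the Orlicz space `L^A(s)` (finiteness of the Luxemburg norm). -/
def MemOrliczOn {n : ℕ} (A : ℝ → ℝ≥0∞) (s : Set (Euc n)) (f : Euc n → ℝ) : Prop :=
  ∃ lam : ℝ, 0 < lam ∧ ∫⁻ x in s, A (|f x| / lam) < ∞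

/-- `u ∈ W^{1,A}_loc(Ω)`, with weak gradient `g`. -/
def MemW1Aloc {n : ℕ} (A : ℝ → ℝ≥0∞) (Ω : Set (Euc n)) (u : Euc n → ℝ)
    (g : Euc n → Euc n) : Prop :=
  IsWeakGradOn Ω u g ∧
    ∀ Ω' : Set (Euc n), IsOpen Ω' → IsCompact (closure Ω') → closure Ω' ⊆ Ω →
      MemOrliczOn A Ω' u ∧ MemOrliczOn A Ω' (fun x => ‖g x‖)

/-- `v ∈ W^{1,1}_0(Ω')`: `v` has a weak gradient on `Ω'` and is approximable in the
`W^{1,1}(Ω')` norm by smooth functions compactly supported in `Ω'`. -/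
def MemW110 {n : ℕ} (Ω' : Set (Euc n)) (v : Euc n → ℝ) : Prop :=
  ∃ h : Euc n → Euc n, IsWeakGradOn Ω' v h ∧
    ∃ φ : ℕ → Euc n → ℝ,
      (∀ k, ContDiff ℝ (⊤ : ℕ∞) (φ k) ∧ HasCompactSupport (φ k) ∧ tsupport (φ k) ⊆ Ω') ∧
      Tendsto (fun k => ∫ x in Ω', (|φ k x - v x| + ‖gradient (φ k) x - h x‖))
        atTop (𝓝 0)

/-- `u` is weakly monotone on `Ω`. -/
def WeaklyMonotone {n : ℕ} (Ω : Set (Euc n)) (u : Euc n → ℝ) : Prop :=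
  ∀ Ω' : Set (Euc n), IsOpen Ω' → IsCompact (closure Ω') → closure Ω' ⊆ Ω →
    ∀ m M : ℝ, m ≤ M →
      MemW110 Ω' (fun x => max (u x - M) 0 - max (m - u x) 0) →
      ∀ᵐ x ∂volume.restrict Ω', m ≤ u x ∧ u x ≤ M

/-- The essential oscillation of `u` on a set `s`. -/
def essOsc {n : ℕ} (s : Set (Euc n)) (u : Euc n → ℝ) : ℝ≥0∞ :=
  essSup (fun p : Euc n × Euc n => ENNReal.ofReal |u p.1 - u p.2|)
    ((volume.restrict s).prod (volume.restrict s))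

/-- The Riesz-type kernel `1 / (|x-y|ⁿ Ψ(1/|x-y|))`. -/
def rieszKernel {n : ℕ} (Ψ : ℝ → ℝ≥0∞) (x y : Euc n) : ℝ≥0∞ :=
  (ENNReal.ofReal (‖x - y‖ ^ n) * Ψ (1 / ‖x - y‖))⁻¹

/-- The Riesz-type potential `I_Ψ f`. -/
def rieszPot {n : ℕ} (Ψ : ℝ → ℝ≥0∞) (f : Euc n → ℝ≥0∞) (x : Euc n) : ℝ≥0∞ :=
  ∫⁻ y, f y * rieszKernel Ψ x y

/-- The capacity `C_{Ψ,1}`. -/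
def capPsi {n : ℕ} (Ψ : ℝ → ℝ≥0∞) (E : Set (Euc n)) : ℝ≥0∞ :=
  ⨅ (f : Euc n → ℝ≥0∞) (_ : Measurable f) (_ : ∀ x ∈ E, 1 ≤ rieszPot Ψ f x),
    ∫⁻ x, f x

open ContinuousLinearMap (lsmul)
open scoped Convolution

/-- The mollification of `f` by the normalized bump function `φ`. -/
def mollify {n : ℕ} {F : Type*} [NormedAddCommGroup F] [NormedSpace ℝ F]
    (φ : ContDiffBump (0 : Euc n)) (f : Euc n → F) : Euc n → F :=
  φ.normed volume ⋆[lsmul ℝ ℝ, volume] f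

section Mollify

variable {n : ℕ} {F : Type*} [NormedAddCommGroup F] [NormedSpace ℝ F]

lemma mollify_apply (φ : ContDiffBump (0 : Euc n)) (f : Euc n → F) (x : Euc n) :
    mollify φ f x = ∫ t, φ.normed volume t • f (x - t) := rfl

lemma integrable_normed_bump (φ : ContDiffBump (0 : Euc n)) :
    Integrable (φ.normed volume) (volume : Measure (Euc n)) :=
  φ.integrable_normed

lemma lintegral_enorm_normed_bump (φ : ContDiffBump (0 : Euc n)) :
    ∫⁻ t, ‖φ.normed volume t‖ₑ ∂(volume : Measure (Euc n)) = 1 := by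
  have h := φ.integral_normed (μ := volume)
  have h2 := ofReal_integral_eq_lintegral_ofReal (integrable_normed_bump φ)
    (ae_of_all _ φ.nonneg_normed)
  rw [h] at h2
  rw [← ENNReal.ofReal_one, h2]
  exact lintegral_congr fun t => Real.enorm_of_nonneg (φ.nonneg_normed t)

lemma enorm_mollify_le (φ : ContDiffBump (0 : Euc n)) (f : Euc n → F) (x : Euc n) :
    ‖mollify φ f x‖ₑ ≤ ∫⁻ t, ‖φ.normed volume t‖ₑ * ‖f (x - t)‖ₑ := by
  rw [mollify_apply]
  refine (enorm_integral_le_lintegral_enorm _).trans_eq ?_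
  simp only [enorm_smul]

lemma integrable_mollify (φ : ContDiffBump (0 : Euc n)) {f : Euc n → F} (hf : Integrable f) :
    Integrable (mollify φ f) :=
  (integrable_normed_bump φ).integrable_convolution _ hf

lemma continuous_mollify (φ : ContDiffBump (0 : Euc n)) {f : Euc n → F}
    (hf : LocallyIntegrable f) : Continuous (mollify φ f) :=
  φ.hasCompactSupport_normed.continuous_convolution_left (lsmul ℝ ℝ) φ.continuous_normed hf

lemma mollify_sub (φ : ContDiffBump (0 : Euc n)) {f h : Euc n → F}
    (hf : LocallyIntegrable f) (hh : LocallyIntegrable h) (x : Euc n) :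
    mollify φ (fun y => f y - h y) x = mollify φ f x - mollify φ h x := by
  have key : ∀ g : Euc n → F, LocallyIntegrable g →
      Integrable fun t => φ.normed volume t • g (x - t) := fun g hg =>
    (φ.hasCompactSupport_normed.convolutionExists_left (lsmul ℝ ℝ)
      φ.continuous_normed hg x)
  simp only [mollify_apply, smul_sub]
  exact integral_sub (key f hf) (key h hh)

lemma lintegral_enorm_mollify_le (φ : ContDiffBump (0 : Euc n)) {f : Euc n → F}
    (hf : Integrable f) : ∫⁻ x, ‖mollify φ f x‖ₑ ≤ ∫⁻ x, ‖f x‖ₑ := by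
  have hm : AEMeasurable (Function.uncurry fun (x t : Euc n) =>
      ‖φ.normed volume t‖ₑ * ‖f (x - t)‖ₑ) ((volume : Measure (Euc n)).prod volume) := by
    have := ((integrable_normed_bump φ).convolution_integrand (lsmul ℝ ℝ) hf).1.enorm
    simpa [Function.uncurry_def, enorm_smul] using this
  calc ∫⁻ x, ‖mollify φ f x‖ₑ
      ≤ ∫⁻ x, ∫⁻ t, ‖φ.normed volume t‖ₑ * ‖f (x - t)‖ₑ :=
        lintegral_mono fun x => enorm_mollify_le φ f x
    _ = ∫⁻ t, ∫⁻ x, ‖φ.normed volume t‖ₑ * ‖f (x - t)‖ₑ := lintegral_lintegral_swap hm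
    _ = ∫⁻ t, ‖φ.normed volume t‖ₑ * ∫⁻ x, ‖f x‖ₑ := by
        refine lintegral_congr fun t => ?_
        rw [lintegral_const_mul' _ _ enorm_ne_top,
          lintegral_sub_right_eq_self (fun x => ‖f x‖ₑ) t]
    _ = ∫⁻ x, ‖f x‖ₑ := by
        rw [lintegral_mul_const' _ _ hf.2.ne, lintegral_enorm_normed_bump, one_mul]

lemma tendsto_lintegral_mollify_sub_of_continuous [CompleteSpace F]
    {φ : ℕ → ContDiffBump (0 : Euc n)}
    (hφ : Tendsto (fun k => (φ k).rOut) atTop (𝓝 0)) {f : Euc n → F} (hf : Continuous f)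
    (hc : HasCompactSupport f) :
    Tendsto (fun k => ∫⁻ x, ‖mollify (φ k) f x - f x‖ₑ) atTop (𝓝 0) := by
  obtain ⟨C, hC⟩ := hc.exists_bound_of_continuous hf
  have hC0 : 0 ≤ C := (norm_nonneg _).trans (hC 0)
  set K : Set (Euc n) := cthickening 1 (tsupport f)
  have hK : IsCompact K := hc.isCompact.cthickening
  have hfi : Integrable f := hf.integrable_of_hasCompactSupport hc
  have hzero : Tendsto (fun k => ∫⁻ x, ‖mollify (φ k) f x - f x‖ₑ) atTop
      (𝓝 (∫⁻ _ : Euc n, 0)) := by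
    refine tendsto_lintegral_filter_of_dominated_convergence
      (K.indicator fun _ => ENNReal.ofReal (2 * C)) ?_ ?_ ?_ ?_
    · exact Eventually.of_forall fun k =>
        (((continuous_mollify (φ k) hfi.locallyIntegrable).sub hf).enorm).measurable
    · filter_upwards [hφ.eventually (gt_mem_nhds one_pos)] with k hk
      refine ae_of_all _ fun x => ?_
      by_cases hx : x ∈ K
      · rw [indicator_of_mem hx, ← ofReal_norm]
        refine ENNReal.ofReal_le_ofReal ?_
        have h1 : ‖mollify (φ k) f x‖ ≤ C := by
          rw [mollify_apply]
          calc ‖∫ t, (φ k).normed volume t • f (x - t)‖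
              ≤ ∫ t, (φ k).normed volume t * C := by
                refine norm_integral_le_of_norm_le
                  ((integrable_normed_bump (φ k)).mul_const C) (ae_of_all _ fun t => ?_)
                rw [norm_smul, Real.norm_of_nonneg ((φ k).nonneg_normed t)]
                exact mul_le_mul_of_nonneg_left (hC _) ((φ k).nonneg_normed t)
            _ = C := by rw [integral_mul_const, (φ k).integral_normed, one_mul]
        linarith [norm_sub_le (mollify (φ k) f x) (f x), hC x]
      · have hfx : ∀ t ∈ ball (0 : Euc n) 1, f (x - t) = 0 := by
          intro t ht
          by_contra hne
          refine hx (mem_cthickening_of_dist_le x (x - t) 1 _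
            (subset_tsupport _ hne) ?_)
          simpa [dist_eq_norm] using (mem_ball_zero_iff.1 ht).le
        have h0 : f x = 0 := by simpa using hfx 0 (mem_ball_self one_pos)
        have h1 : mollify (φ k) f x = 0 := by
          rw [mollify_apply]
          refine integral_eq_zero_of_ae (ae_of_all _ fun t => ?_)
          by_cases ht : t ∈ ball (0 : Euc n) 1
          · simp [hfx t ht]
          · have : (φ k).normed volume t = 0 := by
              have hs := (φ k).support_normed_eq (μ := volume)
              by_contra hne
              have : t ∈ ball (0 : Euc n) (φ k).rOut := by
                rw [← hs]; exact hne
              exact ht (ball_subset_ball hk.le this)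
            simp [this]
        simp [indicator_of_notMem hx, h0, h1]
    · rw [lintegral_indicator_const hK.measurableSet]
      exact ENNReal.mul_ne_top ENNReal.ofReal_ne_top hK.measure_lt_top.ne
    · refine ae_of_all _ fun x => ?_
      have := ContDiffBump.convolution_tendsto_right_of_continuous (μ := volume) hφ hf x
      have h2 : Tendsto (fun k => mollify (φ k) f x - f x) atTop (𝓝 (f x - f x)) :=
        this.sub_const _
      simpa using h2.enorm
  simpa using hzero

lemma tendsto_lintegral_mollify_sub [CompleteSpace F]
    {φ : ℕ → ContDiffBump (0 : Euc n)}
    (hφ : Tendsto (fun k => (φ k).rOut) atTop (𝓝 0)) {f : Euc n → F} (hf : Integrable f) :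
    Tendsto (fun k => ∫⁻ x, ‖mollify (φ k) f x - f x‖ₑ) atTop (𝓝 0) := by
  rw [ENNReal.tendsto_nhds_zero]
  intro ε hε
  have hε3 : ε / 3 ≠ 0 := (ENNReal.div_pos hε.ne' (by norm_num)).ne'
  obtain ⟨h, hhc, hfh, hh, hhi⟩ := hf.exists_hasCompactSupport_lintegral_sub_le hε3
  have h1 := tendsto_lintegral_mollify_sub_of_continuous hφ hh hhc
  rw [ENNReal.tendsto_nhds_zero] at h1
  filter_upwards [h1 (ε / 3) hε3.bot_lt] with k hk
  have hfhi : Integrable (fun y => f y - h y) := hf.sub hhi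
  calc ∫⁻ x, ‖mollify (φ k) f x - f x‖ₑ
      ≤ ∫⁻ x, (‖mollify (φ k) (fun y => f y - h y) x‖ₑ
          + ‖mollify (φ k) h x - h x‖ₑ + ‖f x - h x‖ₑ) := by
        refine lintegral_mono fun x => ?_
        rw [mollify_sub (φ k) hf.locallyIntegrable hhi.locallyIntegrable]
        have : mollify (φ k) f x - f x = (mollify (φ k) f x - mollify (φ k) h x)
            + (mollify (φ k) h x - h x) - (f x - h x) := by abel
        conv_lhs => rw [this]
        refine (enorm_sub_le).trans ?_
        gcongr
        exact enorm_add_le _ _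
    _ = (∫⁻ x, ‖mollify (φ k) (fun y => f y - h y) x‖ₑ)
          + (∫⁻ x, ‖mollify (φ k) h x - h x‖ₑ) + ∫⁻ x, ‖f x - h x‖ₑ := by
        have m1 : AEMeasurable (fun x => ‖f x - h x‖ₑ) volume := hfhi.1.enorm
        have m2 : AEMeasurable (fun x => ‖mollify (φ k) h x - h x‖ₑ) volume :=
          ((integrable_mollify (φ k) hhi).sub hhi).1.enorm
        rw [lintegral_add_right' _ m1, lintegral_add_right' _ m2]
    _ ≤ ε / 3 + ε / 3 + ε / 3 := by
        gcongr
        exact (lintegral_enorm_mollify_le (φ k) hfhi).trans hfh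
    _ = ε := ENNReal.add_thirds ε

lemma enorm_mollify_rpow_le (φ : ContDiffBump (0 : Euc n)) {f : Euc n → F}
    (hf : Measurable fun y => ‖f y‖ₑ) {p : ℝ} (hp : 1 ≤ p) (x : Euc n) :
    ‖mollify φ f x‖ₑ ^ p ≤ ∫⁻ t, ‖φ.normed volume t‖ₑ * ‖f (x - t)‖ₑ ^ p := by
  set ν : Measure (Euc n) := volume.withDensity fun t => ‖φ.normed volume t‖ₑ
  have hφm : Measurable fun t => ‖φ.normed (volume : Measure (Euc n)) t‖ₑ :=
    φ.continuous_normed.measurable.enorm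
  have : IsProbabilityMeasure ν := ⟨by
    simp only [ν]
    rw [withDensity_apply _ MeasurableSet.univ, Measure.restrict_univ,
      lintegral_enorm_normed_bump]⟩
  have hfm : Measurable fun t => ‖f (x - t)‖ₑ := hf.comp (measurable_const.sub measurable_id)
  have hconv : ∀ q : ℝ, ∫⁻ t, ‖φ.normed volume t‖ₑ * ‖f (x - t)‖ₑ ^ q
      = ∫⁻ t, ‖f (x - t)‖ₑ ^ q ∂ν := fun q => by
    rw [lintegral_withDensity_eq_lintegral_mul _ hφm (hfm.pow_const q)]; rfl
  have h1 : ‖mollify φ f x‖ₑ ≤ ∫⁻ t, ‖f (x - t)‖ₑ ∂ν := by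
    refine (enorm_mollify_le φ f x).trans_eq ?_
    simpa using hconv 1
  have hp0 : 0 < p := zero_lt_one.trans_le hp
  rw [hconv p]
  refine (ENNReal.rpow_le_rpow h1 hp0.le).trans ?_
  rcases hp.eq_or_lt with rfl | hp'
  · simp
  have hq : p.HolderConjugate (p / (p - 1)) := Real.HolderConjugate.conjExponent hp'
  have := ENNReal.lintegral_mul_le_Lp_mul_Lq ν hq hfm.aemeasurable
    (aemeasurable_const (b := (1 : ℝ≥0∞)))
  simp only [Pi.mul_apply, mul_one, ENNReal.one_rpow, lintegral_const, measure_univ] at this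
  calc (∫⁻ t, ‖f (x - t)‖ₑ ∂ν) ^ p
      ≤ ((∫⁻ t, ‖f (x - t)‖ₑ ^ p ∂ν) ^ (1 / p)) ^ p := ENNReal.rpow_le_rpow this hp0.le
    _ = _ := by rw [← ENNReal.rpow_mul, one_div_mul_cancel hp0.ne', ENNReal.rpow_one]

end Mollify

section Polar

variable {n : ℕ}

/-- The integral of `F` over the sphere of radius `r`, with respect to the angular measure. -/
def sphereInt (F : Euc n → ℝ≥0∞) (r : ℝ) : ℝ≥0∞ :=
  ∫⁻ θ : sphere (0 : Euc n) 1, F (r • (θ : Euc n)) ∂(volume : Measure (Euc n)).toSphere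

lemma measurable_sphereInt {F : Euc n → ℝ≥0∞} (hF : Measurable F) :
    Measurable (sphereInt F) := by
  refine Measurable.lintegral_prod_right'
    (f := fun q : ℝ × sphere (0 : Euc n) 1 => F (q.1 • (q.2 : Euc n))) ?_
  exact hF.comp (measurable_fst.smul (measurable_subtype_coe.comp measurable_snd))

lemma lintegral_polar (hn : n ≠ 0) {F : Euc n → ℝ≥0∞} (hF : Measurable F) :
    ∫⁻ x, F x = ∫⁻ r in Ioi (0 : ℝ), ENNReal.ofReal (r ^ (n - 1)) * sphereInt F r := by
  have : Nonempty (Fin n) := ⟨⟨0, Nat.pos_of_ne_zero hn⟩⟩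
  have : Nontrivial (Euc n) := inferInstance
  have hdim : Module.finrank ℝ (Euc n) = n := by simp
  have hmp := (volume : Measure (Euc n)).measurePreserving_homeomorphUnitSphereProd
  calc ∫⁻ x, F x = ∫⁻ x in ({0}ᶜ : Set (Euc n)), F x := by rw [restrict_compl_singleton]
    _ = ∫⁻ x : ({0}ᶜ : Set (Euc n)), F x ∂((volume : Measure (Euc n)).comap (↑)) := by
        rw [lintegral_subtype_comap (measurableSet_singleton _).compl]
    _ = ∫⁻ q, F ((q.2 : ℝ) • (q.1 : Euc n)) ∂((volume : Measure (Euc n)).toSphere.prod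
          (Measure.volumeIoiPow (Module.finrank ℝ (Euc n) - 1))) := by
        rw [← hmp.lintegral_comp_emb (Homeomorph.measurableEmbedding _)]
        refine lintegral_congr fun x => ?_
        congr 1
        have hx : ‖(x : Euc n)‖ ≠ 0 := norm_ne_zero_iff.2 x.2
        simp [smul_smul, hx]
    _ = ∫⁻ r : Ioi (0 : ℝ), sphereInt F r ∂(Measure.volumeIoiPow (Module.finrank ℝ (Euc n) - 1)) := by
        rw [lintegral_prod_symm]
        · rfl
        refine Measurable.aemeasurable ?_
        exact hF.comp ((measurable_subtype_coe.comp measurable_snd).smul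
          (measurable_subtype_coe.comp measurable_fst))
    _ = _ := by
        rw [Measure.volumeIoiPow, hdim,
          lintegral_withDensity_eq_lintegral_mul _
            ((measurable_subtype_coe.pow_const _).ennreal_ofReal)
            (g := fun r : Ioi (0 : ℝ) => sphereInt F r)
            ((measurable_sphereInt hF).comp measurable_subtype_coe)]
        exact lintegral_subtype_comap measurableSet_Ioi
          (fun r : ℝ => ENNReal.ofReal (r ^ (n - 1)) * sphereInt F r)

lemma ae_ae_sphere (hn : n ≠ 0) {P : Euc n → Prop} (h : ∀ᵐ x, P x) :
    ∀ᵐ r ∂(volume.restrict (Ioi (0 : ℝ))), ∀ᵐ θ : sphere (0 : Euc n) 1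
      ∂(volume : Measure (Euc n)).toSphere, P (r • (θ : Euc n)) := by
  set N : Set (Euc n) := toMeasurable volume {x | ¬ P x}
  have hN : MeasurableSet N := measurableSet_toMeasurable _ _
  have hN0 : volume N = 0 := by rw [measure_toMeasurable]; exact h
  have hpol := lintegral_polar hn (F := N.indicator 1) (measurable_one.indicator hN)
  rw [lintegral_indicator_one hN, hN0] at hpol
  have hmeas : Measurable fun r : ℝ => ENNReal.ofReal (r ^ (n - 1)) *
      sphereInt (N.indicator 1) r :=
    ((measurable_id.pow_const _).ennreal_ofReal).mul
      (measurable_sphereInt (measurable_one.indicator hN))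
  have hz := (lintegral_eq_zero_iff hmeas).1 hpol.symm
  filter_upwards [hz, ae_restrict_mem measurableSet_Ioi] with r hr hr0
  have hr0' : ENNReal.ofReal (r ^ (n - 1)) ≠ 0 := by
    simpa using pow_pos (mem_Ioi.1 hr0) (n - 1)
  have hr1 := (mul_eq_zero.1 hr).resolve_left hr0'
  have hm : Measurable fun θ : sphere (0 : Euc n) 1 =>
      N.indicator (1 : Euc n → ℝ≥0∞) (r • (θ : Euc n)) :=
    (measurable_one.indicator hN).comp (measurable_subtype_coe.const_smul r)
  filter_upwards [(lintegral_eq_zero_iff hm).1 hr1] with θ hθ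
  by_contra hP
  have : r • (θ : Euc n) ∈ N := subset_toMeasurable _ _ hP
  simp [indicator_of_mem this] at hθ

end Polar

section SphereMorrey

variable {n : ℕ}

/-- Radial projection onto the unit sphere. -/
def radialProj (x : Euc n) : Euc n := ‖x‖⁻¹ • x

lemma radialProj_of_norm_eq_one {a : Euc n} (ha : ‖a‖ = 1) : radialProj a = a := by
  simp [radialProj, ha]

lemma measurable_radialProj : Measurable (radialProj : Euc n → Euc n) :=
  measurable_norm.inv.smul measurable_id

lemma radialProj_smul {r : ℝ} (hr : 0 < r) {θ : Euc n} (hθ : ‖θ‖ = 1) :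
    radialProj (r • θ) = θ := by
  simp [radialProj, norm_smul, hθ, abs_of_pos hr, smul_smul, hr.ne']

lemma norm_radialProj_sub_le (x : Euc n) {y : Euc n} (hy : y ≠ 0) :
    ‖radialProj x - radialProj y‖ ≤ 2 / ‖y‖ * ‖x - y‖ := by
  have hy' : 0 < ‖y‖ := norm_pos_iff.2 hy
  rcases eq_or_ne x 0 with rfl | hx
  · have : ‖radialProj y‖ = 1 := by simp [radialProj, norm_smul, hy'.ne']
    have h0 : radialProj (0 : Euc n) = 0 := by simp [radialProj]
    rw [h0, zero_sub, norm_neg, this, zero_sub, norm_neg]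
    field_simp
    norm_num
  have hx' : 0 < ‖x‖ := norm_pos_iff.2 hx
  have h1 : radialProj x - radialProj y = ‖y‖⁻¹ • (x - y) + (‖x‖⁻¹ - ‖y‖⁻¹) • x := by
    simp only [radialProj, smul_sub, sub_smul]; abel
  have h2 : ‖(‖x‖⁻¹ - ‖y‖⁻¹) • x‖ ≤ ‖y‖⁻¹ * ‖x - y‖ := by
    have h3 : (‖x‖⁻¹ - ‖y‖⁻¹) = (‖y‖ - ‖x‖) * (‖x‖⁻¹ * ‖y‖⁻¹) := by field_simp
    rw [norm_smul, h3, norm_mul, Real.norm_of_nonneg (by positivity : 0 ≤ ‖x‖⁻¹ * ‖y‖⁻¹)]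
    have h4 : ‖(‖y‖ - ‖x‖)‖ ≤ ‖x - y‖ := by
      rw [norm_sub_rev x y]; exact abs_norm_sub_norm_le y x
    calc ‖(‖y‖ - ‖x‖)‖ * (‖x‖⁻¹ * ‖y‖⁻¹) * ‖x‖ = ‖y‖⁻¹ * ‖(‖y‖ - ‖x‖)‖ := by field_simp
      _ ≤ _ := by gcongr
  rw [h1]
  refine (norm_add_le _ _).trans ?_
  rw [norm_smul, norm_inv, norm_norm]
  calc _ ≤ ‖y‖⁻¹ * ‖x - y‖ + ‖y‖⁻¹ * ‖x - y‖ := by gcongr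
    _ = _ := by ring

lemma le_norm_segment {a e y : Euc n} (ha : ‖a‖ = 1) (he : ‖e‖ = 1) (hae : 0 ≤ inner ℝ a e)
    (hy : y ∈ ball e (1 / 4)) {t : ℝ} (ht : t ∈ Icc (0 : ℝ) 1) :
    2 / 5 ≤ ‖a + t • (y - a)‖ := by
  have h1 : a + t • (y - a) = ((1 - t) • a + t • e) + t • (y - e) := by
    simp only [smul_sub, sub_smul, one_smul]; abel
  have h2 : 7 / 10 ≤ ‖(1 - t) • a + t • e‖ := by
    have : ‖(1 - t) • a + t • e‖ ^ 2 = (1 - t) ^ 2 + 2 * ((1 - t) * t * inner ℝ a e) + t ^ 2 := by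
      rw [norm_add_sq_real, norm_smul, norm_smul, ha, he, real_inner_smul_left,
        real_inner_smul_right]
      simp; ring
    have h5 : 0 ≤ (1 - t) * t * inner ℝ a e :=
      mul_nonneg (mul_nonneg (by linarith [ht.2]) ht.1) hae
    by_contra! hlt
    nlinarith [norm_nonneg ((1 - t) • a + t • e), sq_nonneg (2 * t - 1)]
  have h3 : ‖t • (y - e)‖ ≤ 1 / 4 := by
    rw [norm_smul, Real.norm_of_nonneg ht.1]
    have := mem_ball_iff_norm.1 hy
    nlinarith [norm_nonneg (y - e), ht.1, ht.2]
  rw [h1]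
  have := norm_sub_le_norm_add ((1 - t) • a + t • e) (t • (y - e))
  linarith

lemma enorm_sub_le_lintegral_segment {w : Euc n → ℝ} (hw : ContDiff ℝ 1 w)
    {a e y : Euc n} (ha : ‖a‖ = 1) (he : ‖e‖ = 1) (hae : 0 ≤ inner ℝ a e)
    (hy : y ∈ ball e (1 / 4)) :
    ‖w (radialProj y) - w a‖ₑ ≤
      15 * ∫⁻ t in Ioo (0 : ℝ) 1, ‖fderiv ℝ w (radialProj (a + t • (y - a)))‖ₑ := by
  set γ : ℝ → Euc n := fun t => a + t • (y - a)
  have hγne : ∀ t ∈ Icc (0 : ℝ) 1, γ t ≠ 0 := fun t ht h0 => by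
    have := le_norm_segment ha he hae hy ht
    change 2 / 5 ≤ ‖γ t‖ at this
    rw [h0, norm_zero] at this
    norm_num at this
  have hγc : ContDiff ℝ 1 γ := by fun_prop
  have hNγ : ∀ t ∈ Icc (0 : ℝ) 1, ContDiffAt ℝ 1 (fun s => radialProj (γ s)) t := fun t ht =>
    ((hγc.contDiffAt.norm ℝ (hγne t ht)).inv (norm_ne_zero_iff.2 (hγne t ht))).smul
      hγc.contDiffAt
  have hF : ContDiffOn ℝ 1 (fun s => w (radialProj (γ s))) (Icc 0 1) := fun t ht =>
    (hw.contDiffAt.comp t (hNγ t ht)).contDiffWithinAt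
  have h := enorm_sub_le_lintegral_deriv_of_contDiffOn_Icc hF zero_le_one
  have hδ : ‖y - a‖ ≤ 3 := by
    have h1 : y - a = (y - e) + (e - a) := by abel
    have h2 := mem_ball_iff_norm.1 hy
    have h3 := norm_sub_le e a
    rw [h1]
    refine (norm_add_le _ _).trans ?_
    linarith
  have hb : ∀ t ∈ Ioo (0 : ℝ) 1, ‖deriv (fun s => w (radialProj (γ s))) t‖ₑ
      ≤ 15 * ‖fderiv ℝ w (radialProj (γ t))‖ₑ := fun t ht => by
    have ht' := Ioo_subset_Icc_self ht
    have hd1 : deriv (fun s => w (radialProj (γ s))) t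
        = fderiv ℝ w (radialProj (γ t)) (deriv (fun s => radialProj (γ s)) t) :=
      ((hw.differentiable one_ne_zero _).hasFDerivAt.comp_hasDerivAt t
        ((hNγ t ht').differentiableAt one_ne_zero).hasDerivAt).deriv
    have hd2 : ‖deriv (fun s => radialProj (γ s)) t‖ ≤ 15 := by
      refine norm_deriv_le_of_lip' (by norm_num) (Eventually.of_forall fun s => ?_)
      refine (norm_radialProj_sub_le _ (hγne t ht')).trans ?_
      have h1 : γ s - γ t = (s - t) • (y - a) := by simp only [γ, sub_smul]; abel
      rw [h1, norm_smul]
      have h2 : 2 / ‖γ t‖ ≤ 5 := by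
        have h25 := le_norm_segment ha he hae hy ht'
        change 2 / 5 ≤ ‖γ t‖ at h25
        rw [div_le_iff₀ (by linarith)]
        linarith
      calc 2 / ‖γ t‖ * (‖s - t‖ * ‖y - a‖) ≤ 5 * (‖s - t‖ * 3) := by gcongr
        _ = 15 * ‖s - t‖ := by ring
    have h3 : ‖deriv (fun s => w (radialProj (γ s))) t‖
        ≤ 15 * ‖fderiv ℝ w (radialProj (γ t))‖ := by
      rw [hd1]
      refine (ContinuousLinearMap.le_opNorm _ _).trans ?_
      rw [mul_comm]
      gcongr
    rw [← ofReal_norm, ← ofReal_norm]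
    refine (ENNReal.ofReal_le_ofReal h3).trans_eq ?_
    rw [ENNReal.ofReal_mul (by norm_num)]
    norm_num
  have e1 : γ 1 = y := by simp [γ]
  have e0 : γ 0 = a := by simp [γ]
  simp only [e1, e0, radialProj_of_norm_eq_one ha] at h
  refine h.trans ?_
  rw [← restrict_Ioo_eq_restrict_Icc]
  refine (setLIntegral_mono' measurableSet_Ioo hb).trans_eq ?_
  rw [lintegral_const_mul' _ _ (by norm_num)]

lemma lintegral_comp_segment {a : Euc n} {t : ℝ} (ht : 0 < t) {F : Euc n → ℝ≥0∞}
    (hF : Measurable F) :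
    ∫⁻ y, F (a + t • (y - a)) = ENNReal.ofReal (t ^ n)⁻¹ * ∫⁻ z, F z := by
  have h0 : ∀ y : Euc n, a + t • (y - a) = t • y + (a - t • a) := fun y => by
    rw [smul_sub]; abel
  simp_rw [h0]
  have hG : Measurable fun z : Euc n => F (z + (a - t • a)) :=
    hF.comp (measurable_id.add_const _)
  have := lintegral_map (μ := (volume : Measure (Euc n))) hG (measurable_const_smul t)
  rw [← this, Measure.map_addHaar_smul _ ht.ne', lintegral_smul_measure,
    lintegral_add_right_eq_self F (a - t • a)]
  simp [abs_of_pos ht]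

lemma lintegral_annulus_le (hn : n ≠ 0) {F : Euc n → ℝ≥0∞} (hF : Measurable F)
    {t : ℝ} (ht : t ∈ Ioo (0 : ℝ) 1) :
    ∫⁻ z, {z : Euc n | |‖z‖ - 1| ≤ 3 * t}.indicator (fun z => F (radialProj z)) z
      ≤ ENNReal.ofReal (4 ^ (n - 1) * (6 * t)) * sphereInt F 1 := by
  have hA : MeasurableSet {z : Euc n | |‖z‖ - 1| ≤ 3 * t} :=
    measurableSet_le ((measurable_norm.sub_const 1).abs) measurable_const
  have hm : Measurable ({z : Euc n | |‖z‖ - 1| ≤ 3 * t}.indicator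
      (fun z => F (radialProj z))) := (hF.comp measurable_radialProj).indicator hA
  rw [lintegral_polar hn hm]
  have hle : ∀ r ∈ Ioi (0 : ℝ), ENNReal.ofReal (r ^ (n - 1)) *
      sphereInt ({z : Euc n | |‖z‖ - 1| ≤ 3 * t}.indicator (fun z => F (radialProj z))) r
      ≤ (Icc (1 - 3 * t) (1 + 3 * t)).indicator
        (fun _ => ENNReal.ofReal (4 ^ (n - 1)) * sphereInt F 1) r := by
    intro r hr
    have hr0 : 0 < r := hr
    by_cases hrt : r ∈ Icc (1 - 3 * t) (1 + 3 * t)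
    · rw [indicator_of_mem hrt]
      gcongr
      · linarith [hrt.2, ht.2]
      · refine lintegral_mono fun θ => ?_
        have hθ : ‖(θ : Euc n)‖ = 1 := by simp
        refine (indicator_le_self _ _ _).trans_eq ?_
        rw [radialProj_smul hr0 hθ, one_smul]
    · rw [indicator_of_notMem hrt]
      have : sphereInt ({z : Euc n | |‖z‖ - 1| ≤ 3 * t}.indicator
          (fun z => F (radialProj z))) r = 0 := by
        refine (lintegral_congr fun θ => ?_).trans lintegral_zero
        refine indicator_of_notMem (fun hmem => hrt ?_) _
        simp only [mem_ofPred_eq, norm_smul, Real.norm_eq_abs, abs_of_pos hr0,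
          norm_eq_of_mem_sphere, mul_one, abs_le] at hmem
        constructor <;> linarith [hmem.1, hmem.2]
      rw [this, mul_zero]
  refine (setLIntegral_mono' measurableSet_Ioi hle).trans ?_
  refine (setLIntegral_le_lintegral _ _).trans ?_
  rw [lintegral_indicator_const measurableSet_Icc, Real.volume_Icc,
    show 1 + 3 * t - (1 - 3 * t) = 6 * t by ring, mul_right_comm,
    ← ENNReal.ofReal_mul (by positivity)]

lemma lintegral_ball_segment_le (hn : n ≠ 0) {F : Euc n → ℝ≥0∞} (hF : Measurable F)
    {p : ℝ} (hp : 1 < p) {a e : Euc n} (ha : ‖a‖ = 1) (he : ‖e‖ = 1)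
    {t : ℝ} (ht : t ∈ Ioo (0 : ℝ) 1) :
    ∫⁻ y in ball e (1 / 4), F (radialProj (a + t • (y - a)))
      ≤ volume (ball e (1 / 4)) ^ (1 / (p / (p - 1))) *
        (ENNReal.ofReal (4 ^ (n - 1) * 6) ^ (1 / p) *
          ENNReal.ofReal (t ^ ((1 - n : ℝ) / p)) * sphereInt (fun x => F x ^ p) 1 ^ (1 / p)) := by
  have hp0 : 0 < p := by linarith
  have hq : p.HolderConjugate (p / (p - 1)) := Real.HolderConjugate.conjExponent hp
  have hseg : Measurable fun y : Euc n => a + t • (y - a) := by fun_prop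
  have hFm : Measurable fun y => F (radialProj (a + t • (y - a))) :=
    hF.comp (measurable_radialProj.comp hseg)
  have h1 := ENNReal.lintegral_mul_le_Lp_mul_Lq (volume.restrict (ball e (1 / 4))) hq
    hFm.aemeasurable (aemeasurable_const (b := (1 : ℝ≥0∞)))
  simp only [Pi.mul_apply, mul_one, ENNReal.one_rpow, lintegral_const, one_mul,
    Measure.restrict_apply MeasurableSet.univ, univ_inter] at h1
  refine h1.trans ?_
  rw [mul_comm]
  gcongr
  have hA : MeasurableSet {z : Euc n | |‖z‖ - 1| ≤ 3 * t} :=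
    measurableSet_le ((measurable_norm.sub_const 1).abs) measurable_const
  have hFp : Measurable fun z => F z ^ p := hF.pow_const p
  have h2 : ∫⁻ y in ball e (1 / 4), F (radialProj (a + t • (y - a))) ^ p
      ≤ ENNReal.ofReal (4 ^ (n - 1) * 6) * ENNReal.ofReal (t ^ (1 - n : ℝ)) *
        sphereInt (fun x => F x ^ p) 1 := by
    calc ∫⁻ y in ball e (1 / 4), F (radialProj (a + t • (y - a))) ^ p
        ≤ ∫⁻ y, {z : Euc n | |‖z‖ - 1| ≤ 3 * t}.indicator (fun z => F (radialProj z) ^ p)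
            (a + t • (y - a)) := by
          rw [← lintegral_indicator measurableSet_ball]
          refine lintegral_mono fun y => ?_
          by_cases hy : y ∈ ball e (1 / 4)
          · rw [indicator_of_mem hy, indicator_of_mem]
            have hδ : ‖y - a‖ ≤ 3 := by
              have h1 : y - a = (y - e) + (e - a) := by abel
              have h2 := mem_ball_iff_norm.1 hy
              have h3 := norm_sub_le e a
              rw [h1]
              refine (norm_add_le _ _).trans ?_
              linarith
            have h4 := abs_norm_sub_norm_le (a + t • (y - a)) a
            rw [ha, add_sub_cancel_left, norm_smul, Real.norm_of_nonneg ht.1.le] at h4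
            exact h4.trans (by nlinarith [ht.1])
          · rw [indicator_of_notMem hy]
            exact zero_le
      _ = ENNReal.ofReal (t ^ n)⁻¹ * ∫⁻ z, {z : Euc n | |‖z‖ - 1| ≤ 3 * t}.indicator
            (fun z => F (radialProj z) ^ p) z :=
          lintegral_comp_segment ht.1 ((hFp.comp measurable_radialProj).indicator hA)
      _ ≤ ENNReal.ofReal (t ^ n)⁻¹ * (ENNReal.ofReal (4 ^ (n - 1) * (6 * t)) *
            sphereInt (fun x => F x ^ p) 1) := by
          gcongr
          exact lintegral_annulus_le hn hFp ht
      _ = _ := by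
          rw [← mul_assoc, ← ENNReal.ofReal_mul (by have := ht.1; positivity),
            ← ENNReal.ofReal_mul (by positivity)]
          congr 2
          rw [Real.rpow_sub ht.1, Real.rpow_one, Real.rpow_natCast]
          ring
  refine (ENNReal.rpow_le_rpow h2 (by positivity)).trans_eq ?_
  rw [ENNReal.mul_rpow_of_nonneg _ _ (by positivity), ENNReal.mul_rpow_of_nonneg _ _
    (by positivity), ENNReal.ofReal_rpow_of_pos (Real.rpow_pos_of_pos ht.1 _),
    ← Real.rpow_mul ht.1.le, mul_one_div]

lemma exists_unit_inner_nonneg (hn : 2 ≤ n) {a b : Euc n} (ha : ‖a‖ = 1) (hb : ‖b‖ = 1) :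
    ∃ e : Euc n, ‖e‖ = 1 ∧ 0 ≤ inner ℝ a e ∧ 0 ≤ inner ℝ b e := by
  by_cases hab : a + b = 0
  · have hfact : Fact (Module.finrank ℝ (Euc n) = (n - 1) + 1) := ⟨by simp; omega⟩
    have ha0 : a ≠ 0 := fun h => by simp [h] at ha
    have hfin := finrank_euclideanSpace_fin (𝕜 := ℝ) (n := n)
    have h1 := Submodule.finrank_orthogonal_span_singleton (𝕜 := ℝ) (n := n - 1) ha0
    have hne : (Submodule.span ℝ {a})ᗮ ≠ ⊥ := fun h => by
      rw [h, finrank_bot] at h1; omega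
    obtain ⟨v, hv, hv0⟩ := Submodule.exists_mem_ne_zero_of_ne_bot hne
    have hav : inner ℝ a v = 0 := Submodule.mem_orthogonal_singleton_iff_inner_right.1 hv
    have hba : b = -a := by rw [eq_neg_iff_add_eq_zero, add_comm]; exact hab
    refine ⟨‖v‖⁻¹ • v, by simp [norm_smul, hv0], ?_, ?_⟩
    · rw [real_inner_smul_right, hav, mul_zero]
    · rw [hba, inner_neg_left, real_inner_smul_right, hav, mul_zero, neg_zero]
  · have h1 := abs_real_inner_le_norm a b
    rw [ha, hb, one_mul, abs_le] at h1
    refine ⟨‖a + b‖⁻¹ • (a + b), by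
      rw [norm_smul, norm_inv, norm_norm, inv_mul_cancel₀ (norm_ne_zero_iff.2 hab)], ?_, ?_⟩
    · rw [real_inner_smul_right, inner_add_right, real_inner_self_eq_norm_sq, ha]
      exact mul_nonneg (by positivity) (by linarith)
    · rw [real_inner_smul_right, inner_add_right, real_inner_self_eq_norm_sq, hb,
        real_inner_comm]
      exact mul_nonneg (by positivity) (by linarith)

/-- Morrey's inequality on the unit sphere of `ℝⁿ`, for exponents `p > n - 1`. -/
theorem exists_sphere_morrey (hn : 2 ≤ n) {p : ℝ} (hp : (n : ℝ) - 1 < p) :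
    ∃ C : ℝ≥0∞, C ≠ ∞ ∧ ∀ w : Euc n → ℝ, ContDiff ℝ 1 w → ∀ a b : Euc n, ‖a‖ = 1 → ‖b‖ = 1 →
      ‖w a - w b‖ₑ ≤ C * sphereInt (fun x => ‖fderiv ℝ w x‖ₑ ^ p) 1 ^ (1 / p) := by
  have hn0 : n ≠ 0 := by omega
  have hn2 : (2 : ℝ) ≤ n := by exact_mod_cast hn
  have hp1 : 1 < p := by linarith
  have hp0 : 0 < p := by linarith
  set V : ℝ≥0∞ := volume (ball (0 : Euc n) (1 / 4))
  have hV0 : V ≠ 0 := (measure_ball_pos _ _ (by norm_num)).ne'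
  have hVt : V ≠ ∞ := measure_ball_lt_top.ne
  set J : ℝ≥0∞ := ∫⁻ t in Ioo (0 : ℝ) 1, ENNReal.ofReal (t ^ ((1 - n : ℝ) / p))
  have hJ : J ≠ ∞ := by
    have hfint : IntegrableOn (fun t : ℝ => t ^ ((1 - n : ℝ) / p)) (Ioo 0 1) := by
      rw [intervalIntegral.integrableOn_Ioo_rpow_iff one_pos, lt_div_iff₀ hp0]
      linarith
    have := hfint.2
    rw [hasFiniteIntegral_iff_ofReal] at this
    · exact this.ne
    · filter_upwards [ae_restrict_mem measurableSet_Ioo] with t ht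
      exact Real.rpow_nonneg ht.1.le _
  set K : ℝ≥0∞ := V ^ (1 / (p / (p - 1))) * ENNReal.ofReal (4 ^ (n - 1) * 6) ^ (1 / p)
  have hK : K ≠ ∞ := ENNReal.mul_ne_top
    (ENNReal.rpow_ne_top_of_nonneg (by have : 0 < p - 1 := by linarith
                                       positivity) hVt)
    (ENNReal.rpow_ne_top_of_nonneg (by positivity) ENNReal.ofReal_ne_top)
  refine ⟨2 * (15 * (K * J)) / V, ENNReal.div_ne_top (ENNReal.mul_ne_top (by norm_num)
    (ENNReal.mul_ne_top (by norm_num) (ENNReal.mul_ne_top hK hJ))) hV0, ?_⟩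
  intro w hw a b ha hb
  obtain ⟨e, he, hae, hbe⟩ := exists_unit_inner_nonneg hn ha hb
  set D : ℝ≥0∞ := sphereInt (fun x => ‖fderiv ℝ w x‖ₑ ^ p) 1 ^ (1 / p)
  have hHm : Measurable fun x => ‖fderiv ℝ w x‖ₑ :=
    ((hw.continuous_fderiv one_ne_zero).enorm).measurable
  have hVe : volume (ball e (1 / 4)) = V := Measure.addHaar_ball_center _ _ _
  have key : ∀ c : Euc n, ‖c‖ = 1 → 0 ≤ inner ℝ c e →
      ∫⁻ y in ball e (1 / 4), ‖w (radialProj y) - w c‖ₑ ≤ 15 * (K * J) * D := by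
    intro c hc hce
    have hm : Measurable (Function.uncurry fun (y : Euc n) (t : ℝ) =>
        ‖fderiv ℝ w (radialProj (c + t • (y - c)))‖ₑ) :=
      hHm.comp (measurable_radialProj.comp (by fun_prop))
    calc ∫⁻ y in ball e (1 / 4), ‖w (radialProj y) - w c‖ₑ
        ≤ ∫⁻ y in ball e (1 / 4), 15 * ∫⁻ t in Ioo (0 : ℝ) 1,
            ‖fderiv ℝ w (radialProj (c + t • (y - c)))‖ₑ :=
          setLIntegral_mono' measurableSet_ball fun y hy =>
            enorm_sub_le_lintegral_segment hw hc he hce hy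
      _ = 15 * ∫⁻ t in Ioo (0 : ℝ) 1, ∫⁻ y in ball e (1 / 4),
            ‖fderiv ℝ w (radialProj (c + t • (y - c)))‖ₑ := by
          rw [lintegral_const_mul' _ _ (by norm_num), lintegral_lintegral_swap hm.aemeasurable]
      _ ≤ 15 * ∫⁻ t in Ioo (0 : ℝ) 1, (K * D) * ENNReal.ofReal (t ^ ((1 - n : ℝ) / p)) := by
          gcongr 15 * ?_
          refine setLIntegral_mono' measurableSet_Ioo fun t ht => ?_
          refine (lintegral_ball_segment_le hn0 hHm hp1 hc he ht).trans_eq ?_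
          rw [hVe]
          simp only [K, D]
          ring
      _ = 15 * (K * J) * D := by
          rw [lintegral_const_mul _ (by fun_prop)]
          ring
  have hfin : V * ‖w a - w b‖ₑ ≤ 2 * (15 * (K * J)) * D := by
    calc V * ‖w a - w b‖ₑ = ∫⁻ _ in ball e (1 / 4), ‖w a - w b‖ₑ := by
          rw [setLIntegral_const, hVe, mul_comm]
      _ ≤ ∫⁻ y in ball e (1 / 4), (‖w (radialProj y) - w a‖ₑ + ‖w (radialProj y) - w b‖ₑ) := by
          refine lintegral_mono fun y => ?_
          have : w a - w b = (w (radialProj y) - w b) - (w (radialProj y) - w a) := by ring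
          dsimp only
          rw [this, add_comm]
          exact enorm_sub_le
      _ = (∫⁻ y in ball e (1 / 4), ‖w (radialProj y) - w a‖ₑ)
          + ∫⁻ y in ball e (1 / 4), ‖w (radialProj y) - w b‖ₑ := by
          rw [lintegral_add_left]
          exact ((hw.continuous.measurable.comp measurable_radialProj).sub_const _).enorm
      _ ≤ 15 * (K * J) * D + 15 * (K * J) * D := add_le_add (key a ha hae) (key b hb hbe)
      _ = _ := by ring
  rw [ENNReal.mul_comm_div, ← mul_div_assoc, ENNReal.le_div_iff_mul_le (Or.inl hV0) (Or.inl hVt),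
    mul_comm]
  exact hfin

end SphereMorrey

section WeakGradient

variable {n : ℕ} {Ω : Set (Euc n)} {u : Euc n → ℝ} {g : Euc n → Euc n}

lemma integrable_mul_of_tsupport_subset {f φ : Euc n → ℝ} (hf : LocallyIntegrableOn f Ω volume)
    (hφ : Continuous φ) (hφc : HasCompactSupport φ) (hφΩ : tsupport φ ⊆ Ω) :
    Integrable fun x => f x * φ x := by
  have h1 : IntegrableOn f (tsupport φ) :=
    (hf.mono_set hφΩ).integrableOn_isCompact hφc
  have h2 : IntegrableOn (fun x => f x * φ x) (tsupport φ) := by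
    simpa only [mul_comm] using h1.continuousOn_mul hφ.continuousOn hφc
  refine (integrableOn_iff_integrable_of_support_subset ?_).1 h2
  exact (Function.support_mul_subset_right f φ).trans (subset_tsupport φ)

lemma integrable_mul_fderiv {f φ : Euc n → ℝ} (hf : LocallyIntegrableOn f Ω volume)
    (hφ : ContDiff ℝ (⊤ : ℕ∞) φ) (hφc : HasCompactSupport φ) (hφΩ : tsupport φ ⊆ Ω) (v : Euc n) :
    Integrable fun x => f x * fderiv ℝ φ x v := by
  refine integrable_mul_of_tsupport_subset hf ?_ ?_ ((tsupport_fderiv_apply_subset ℝ v).trans hφΩ)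
  · exact (hφ.continuous_fderiv (by simp)).clm_apply continuous_const
  · exact hφc.of_isClosed_subset (isClosed_tsupport _) (tsupport_fderiv_apply_subset ℝ v)

lemma locallyIntegrableOn_of_forall_integrable_mul (hΩ : IsOpen Ω) {f : Euc n → ℝ}
    (hf : ∀ φ : Euc n → ℝ, ContDiff ℝ (⊤ : ℕ∞) φ → HasCompactSupport φ → tsupport φ ⊆ Ω →
      Integrable fun x => f x * φ x) : LocallyIntegrableOn f Ω volume := by
  intro x hx
  obtain ⟨ε, hε, hball⟩ := Metric.isOpen_iff.1 hΩ x hx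
  let φ : ContDiffBump x := ⟨ε / 4, ε / 2, by positivity, by linarith⟩
  have hφ : Integrable fun y => f y * φ y := by
    refine hf φ φ.contDiff φ.hasCompactSupport ?_
    rw [φ.tsupport_eq]
    exact (closedBall_subset_ball (by change ε / 2 < ε; linarith)).trans hball
  refine ⟨ball x (ε / 4), mem_nhdsWithin_of_mem_nhds (ball_mem_nhds x (by positivity)), ?_⟩
  refine hφ.integrableOn.congr_fun (fun y hy => ?_) measurableSet_ball
  change f y * φ y = f y
  rw [φ.one_of_mem_closedBall (ball_subset_closedBall hy), mul_one]

/-- A component of a weak gradient which is not a.e.-measurable integrates to zero against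
all test functions. -/
lemma integral_mul_eq_zero_of_not_aestronglyMeasurable (hΩ : IsOpen Ω)
    (hug : IsWeakGradOn Ω u g) {i : Fin n}
    (hi : ¬ AEStronglyMeasurable (fun x => g x i) (volume.restrict Ω))
    {ψ : Euc n → ℝ} (hψ : ContDiff ℝ (⊤ : ℕ∞) ψ) (hψc : HasCompactSupport ψ)
    (hψΩ : tsupport ψ ⊆ Ω) : ∫ x, g x i * ψ x = 0 := by
  by_cases hfint : Integrable fun x => g x i * ψ x
  swap
  · exact integral_undef hfint
  have hex : ∃ φ : Euc n → ℝ, ContDiff ℝ (⊤ : ℕ∞) φ ∧ HasCompactSupport φ ∧ tsupport φ ⊆ Ω ∧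
      ¬ Integrable fun x => g x i * φ x := by
    by_contra! hcon
    exact hi (locallyIntegrableOn_of_forall_integrable_mul hΩ hcon).aestronglyMeasurable
  obtain ⟨φ, hφ, hφc, hφΩ, hφn⟩ := hex
  have hsum : ¬ Integrable fun x => g x i * (φ + ψ) x := fun h =>
    hφn ((h.sub hfint).congr (ae_of_all _ fun x => by simp [mul_add]))
  have h1 := hug.2.2 φ hφ hφc hφΩ i
  have h2 := hug.2.2 (φ + ψ) (hφ.add hψ) (hφc.add hψc)
    ((tsupport_add φ ψ).trans (union_subset hφΩ hψΩ)) i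
  have h3 := hug.2.2 ψ hψ hψc hψΩ i
  rw [integral_undef hφn, neg_zero] at h1
  rw [integral_undef hsum, neg_zero] at h2
  have h4 : ∀ x, u x * fderiv ℝ (φ + ψ) x (EuclideanSpace.single i 1)
      = u x * fderiv ℝ φ x (EuclideanSpace.single i 1)
        + u x * fderiv ℝ ψ x (EuclideanSpace.single i 1) := fun x => by
    rw [fderiv_add (hφ.differentiable (by simp) x) (hψ.differentiable (by simp) x)]
    simp [mul_add]
  simp only [h4] at h2
  rw [integral_add (integrable_mul_fderiv hug.1 hφ hφc hφΩ _)
    (integrable_mul_fderiv hug.1 hψ hψc hψΩ _), h1, zero_add, h3] at h2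
  linarith

/-- Every weak gradient may be replaced by a measurable one which is pointwise not larger. -/
theorem exists_measurable_weakGrad (hΩ : IsOpen Ω) (hug : IsWeakGradOn Ω u g) :
    ∃ h : Euc n → Euc n, Measurable h ∧ (∀ᵐ x ∂volume.restrict Ω, ‖h x‖ ≤ ‖g x‖) ∧
      IsWeakGradOn Ω u h := by
  classical
  have key : ∀ i : Fin n, ∃ f : Euc n → ℝ, Measurable f ∧
      (∀ᵐ x ∂volume.restrict Ω, ‖f x‖ ≤ ‖g x i‖) ∧
      ∀ φ : Euc n → ℝ, ContDiff ℝ (⊤ : ℕ∞) φ → HasCompactSupport φ → tsupport φ ⊆ Ω →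
        ∫ x, g x i * φ x = ∫ x, f x * φ x := by
    intro i
    by_cases hi : AEStronglyMeasurable (fun x => g x i) (volume.restrict Ω)
    · refine ⟨hi.mk, hi.stronglyMeasurable_mk.measurable, ?_, fun φ hφ hφc hφΩ => ?_⟩
      · filter_upwards [hi.ae_eq_mk] with x hx
        rw [← hx]
      · have hz : ∀ f : Euc n → ℝ, ∫ x in Ω, f x * φ x = ∫ x, f x * φ x := fun f =>
          setIntegral_eq_integral_of_forall_compl_eq_zero fun x hx => by
            rw [image_eq_zero_of_notMem_tsupport fun h => hx (hφΩ h), mul_zero]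
        rw [← hz, ← hz]
        refine integral_congr_ae ?_
        filter_upwards [hi.ae_eq_mk] with x hx
        rw [hx]
    · refine ⟨fun _ => 0, measurable_const, ae_of_all _ fun x => by simp, fun φ hφ hφc hφΩ => ?_⟩
      rw [integral_mul_eq_zero_of_not_aestronglyMeasurable hΩ hug hi hφ hφc hφΩ]
      simp
  choose f hfm hfle hfint using key
  have hm : Measurable fun x => (WithLp.toLp 2 fun i => f i x : Euc n) :=
    (WithLp.measurable_toLp 2 _).comp (measurable_pi_lambda _ hfm)
  have hle : ∀ᵐ x ∂volume.restrict Ω,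
      ‖(WithLp.toLp 2 fun i => f i x : Euc n)‖ ≤ ‖g x‖ := by
    filter_upwards [ae_all_iff.2 hfle] with x hx
    rw [EuclideanSpace.norm_eq, EuclideanSpace.norm_eq]
    refine Real.sqrt_le_sqrt (Finset.sum_le_sum fun i _ => ?_)
    exact pow_le_pow_left₀ (norm_nonneg _) (hx i) 2
  refine ⟨_, hm, hle, hug.1, ?_, fun φ hφ hφc hφΩ i => ?_⟩
  · intro x hx
    obtain ⟨s, hs, hfint⟩ := hug.2.1 x hx
    refine ⟨s ∩ Ω, inter_mem hs self_mem_nhdsWithin, ?_⟩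
    refine Integrable.mono (hfint.mono_set inter_subset_left) hm.norm.aestronglyMeasurable ?_
    filter_upwards [ae_restrict_of_ae_restrict_of_subset inter_subset_right hle] with y hy
    rwa [norm_norm, norm_norm]
  · rw [hug.2.2 φ hφ hφc hφΩ i, hfint i φ hφ hφc hφΩ]

lemma contDiff_mollify (φ : ContDiffBump (0 : Euc n)) {f : Euc n → ℝ} (hf : LocallyIntegrable f) :
    ContDiff ℝ (⊤ : ℕ∞) (mollify φ f) :=
  φ.hasCompactSupport_normed.contDiff_convolution_left (lsmul ℝ ℝ) φ.contDiff_normed hf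

lemma norm_gradient {f : Euc n → ℝ} (x : Euc n) : ‖gradient f x‖ = ‖fderiv ℝ f x‖ :=
  (InnerProductSpace.toDual ℝ (Euc n)).symm.norm_map _

lemma gradient_apply {f : Euc n → ℝ} (x : Euc n) (i : Fin n) :
    gradient f x i = fderiv ℝ f x (EuclideanSpace.single i 1) := by
  have h : inner ℝ (gradient f x) (EuclideanSpace.single i (1 : ℝ))
      = fderiv ℝ f x (EuclideanSpace.single i 1) :=
    InnerProductSpace.toDual_symm_apply
  rw [← h, EuclideanSpace.inner_single_right]
  simp

lemma tsupport_bump_comp_sub (φ : ContDiffBump (0 : Euc n)) (x : Euc n) :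
    tsupport (fun y => φ.normed volume (x - y)) ⊆ closedBall x φ.rOut := by
  refine closure_minimal (fun y hy => ?_) isClosed_closedBall
  have h1 : x - y ∈ Function.support (φ.normed volume) := hy
  rw [φ.support_normed_eq, mem_ball_zero_iff] at h1
  rw [mem_closedBall, dist_comm, dist_eq_norm]
  exact h1.le

/-- Mollification commutes with weak differentiation, away from the boundary. -/
theorem gradient_mollify_indicator (hug : IsWeakGradOn Ω u g) (hgm : Measurable g)
    {x₀ : Euc n} {R : ℝ} (hR : closedBall x₀ R ⊆ Ω) (φ : ContDiffBump (0 : Euc n)) {x : Euc n}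
    (hx : dist x x₀ + φ.rOut ≤ R) :
    gradient (mollify φ ((closedBall x₀ R).indicator u)) x
      = mollify φ ((closedBall x₀ R).indicator g) x := by
  set B := closedBall x₀ R
  have hBc : IsCompact B := isCompact_closedBall x₀ R
  have hu : Integrable (B.indicator u) :=
    ((hug.1.mono_set hR).integrableOn_isCompact hBc).integrable_indicator measurableSet_closedBall
  have hg1 : IntegrableOn g B := by
    have := (hug.2.1.mono_set hR).integrableOn_isCompact hBc
    exact (integrable_norm_iff hgm.aestronglyMeasurable).1 this
  have hg : Integrable (B.indicator g) := hg1.integrable_indicator measurableSet_closedBall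
  have hη : ContDiff ℝ (⊤ : ℕ∞) (φ.normed volume) := φ.contDiff_normed
  have hηx : ContDiff ℝ (⊤ : ℕ∞) fun y => φ.normed volume (x - y) := hη.comp (contDiff_const.sub contDiff_id)
  have hηt := tsupport_bump_comp_sub φ x
  have hsub : closedBall x φ.rOut ⊆ B := closedBall_subset_closedBall' (by linarith)
  have hηc : HasCompactSupport fun y => φ.normed volume (x - y) :=
    (isCompact_closedBall x φ.rOut).of_isClosed_subset (isClosed_tsupport _) hηt
  have hzero : ∀ y ∉ B, φ.normed volume (x - y) = 0 := fun y hy =>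
    image_eq_zero_of_notMem_tsupport (f := fun y => φ.normed volume (x - y))
      fun h => hy (hsub (hηt h))
  ext i
  rw [gradient_apply]
  have hd := (φ.hasCompactSupport_normed (μ := volume)).hasFDerivAt_convolution_left (lsmul ℝ ℝ)
    (hη.of_le (by simp)) hu.locallyIntegrable x
  have hfd : ∀ y, fderiv ℝ (fun y => φ.normed volume (x - y)) y (EuclideanSpace.single i 1)
      = - fderiv ℝ (φ.normed volume) (x - y) (EuclideanSpace.single i 1) := by
    intro y
    have h1 : HasFDerivAt (fun y => φ.normed volume (x - y))
        ((fderiv ℝ (φ.normed volume) (x - y)).comp (-ContinuousLinearMap.id ℝ (Euc n))) y :=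
      ((hη.differentiable (by simp) (x - y)).hasFDerivAt).comp y
        ((hasFDerivAt_id y).const_sub x)
    rw [h1.fderiv]
    simp
  have hL : fderiv ℝ (mollify φ (B.indicator u)) x (EuclideanSpace.single i 1)
      = ∫ y, fderiv ℝ (φ.normed volume) (x - y) (EuclideanSpace.single i 1) * B.indicator u y := by
    rw [show fderiv ℝ (mollify φ (B.indicator u)) x = _ from hd.fderiv]
    have hconv := (φ.hasCompactSupport_normed (μ := volume)).fderiv (𝕜 := ℝ)
    have hce := hconv.convolutionExists_left (ContinuousLinearMap.precompL (Euc n) (lsmul ℝ ℝ))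
      (hη.continuous_fderiv (by simp)) hu.locallyIntegrable x
    rw [convolution_def, ContinuousLinearMap.integral_apply hce]
    rw [← integral_sub_left_eq_self _ volume x]
    refine integral_congr_ae (ae_of_all _ fun y => ?_)
    simp only [ContinuousLinearMap.precompL_apply, ContinuousLinearMap.lsmul_apply, smul_eq_mul]
    rw [show x - (x - y) = y by abel]
  have hRr : mollify φ (B.indicator g) x i = ∫ y, φ.normed volume (x - y) * B.indicator g y i := by
    have hce := (φ.hasCompactSupport_normed (μ := volume)).convolutionExists_left (lsmul ℝ ℝ)
      hη.continuous hg.locallyIntegrable x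
    have hp : mollify φ (B.indicator g) x i
        = (EuclideanSpace.proj i : Euc n →L[ℝ] ℝ) (mollify φ (B.indicator g) x) := rfl
    rw [hp, mollify, convolution_def, ← ContinuousLinearMap.integral_comp_comm _ hce,
      ← integral_sub_left_eq_self _ volume x]
    simp
  rw [hL, hRr]
  have h5 := hug.2.2 _ hηx hηc ((hηt.trans hsub).trans hR) i
  simp only [hfd, mul_neg, integral_neg, neg_inj] at h5
  convert h5 using 1
  · refine integral_congr_ae (ae_of_all _ fun y => ?_)
    by_cases hy : y ∈ B
    · simp [hy, mul_comm]
    · have h6 : fderiv ℝ (fun y => φ.normed volume (x - y)) y (EuclideanSpace.single i 1) = 0 :=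
        image_eq_zero_of_notMem_tsupport
          (f := fun y => fderiv ℝ (fun y => φ.normed volume (x - y)) y (EuclideanSpace.single i 1))
          fun h => hy (hsub (hηt (tsupport_fderiv_apply_subset ℝ _ h)))
      rw [hfd, neg_eq_zero] at h6
      simp [hy, h6]
  · refine integral_congr_ae (ae_of_all _ fun y => ?_)
    by_cases hy : y ∈ B
    · simp [hy, mul_comm]
    · simp [hy, hzero y hy]

end WeakGradient

section Truncation

/-- A smooth approximation of the positive part. -/
lemma exists_smooth_posPart : ∃ (τ : ℝ → ℝ) (L : ℝ), ContDiff ℝ (⊤ : ℕ∞) τ ∧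
    (∀ s ≤ 0, τ s = 0) ∧ (∀ s, |τ s - max s 0| ≤ 1) ∧ (∀ s, |deriv τ s| ≤ L) ∧
    (∀ s < 0, deriv τ s = 0) ∧ ∀ s > 1, deriv τ s = 1 := by
  set τ : ℝ → ℝ := fun s => s * Real.smoothTransition s with hτ
  have hsm : ContDiff ℝ (⊤ : ℕ∞) τ := contDiff_id.mul Real.smoothTransition.contDiff
  have h0 : ∀ s ≤ 0, τ s = 0 := fun s hs => by
    simp [hτ, Real.smoothTransition.zero_of_nonpos hs]
  have h1 : ∀ s, 1 ≤ s → τ s = s := fun s hs => by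
    simp [hτ, Real.smoothTransition.one_of_one_le hs]
  have hd0 : ∀ s < 0, deriv τ s = 0 := fun s hs => by
    have : τ =ᶠ[𝓝 s] fun _ => 0 := by
      filter_upwards [Iio_mem_nhds hs] with r hr using h0 r (le_of_lt hr)
    rw [this.deriv_eq, deriv_const]
  have hd1 : ∀ s > 1, deriv τ s = 1 := fun s hs => by
    have : τ =ᶠ[𝓝 s] fun r => r := by
      filter_upwards [Ioi_mem_nhds hs] with r hr using h1 r (le_of_lt hr)
    rw [this.deriv_eq, deriv_id'']
  obtain ⟨L, hL⟩ := (isCompact_Icc (a := (0 : ℝ)) (b := 1)).exists_bound_of_continuousOn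
    (hsm.continuous_deriv (by simp)).continuousOn
  refine ⟨τ, max L 1, hsm, h0, fun s => ?_, fun s => ?_, hd0, hd1⟩
  · rcases le_or_gt s 0 with hs | hs
    · simp [h0 s hs, max_eq_right hs]
    rcases le_or_gt 1 s with hs1 | hs1
    · simp [h1 s hs1, max_eq_left hs.le]
    · rw [max_eq_left hs.le, abs_le]
      have h2 := Real.smoothTransition.nonneg s
      have h3 := Real.smoothTransition.le_one s
      constructor <;> simp only [hτ] <;> nlinarith
  · rcases lt_or_ge s 0 with hs | hs
    · simp [hd0 s hs]
    rcases lt_or_ge 1 s with hs1 | hs1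
    · simp [hd1 s hs1]
    · exact (hL s ⟨hs, hs1⟩).trans (le_max_left _ _)

/-- Smooth approximations of the truncation `s ↦ (s - M)₊ - (m - s)₊`. -/
lemma exists_smooth_truncation (m M : ℝ) (hmM : m ≤ M) : ∃ (T : ℕ → ℝ → ℝ) (L : ℝ),
    (∀ k, ContDiff ℝ (⊤ : ℕ∞) (T k)) ∧ (∀ k, ∀ s ∈ Icc m M, T k s = 0) ∧
    (∀ (k : ℕ) s, |T k s - (max (s - M) 0 - max (m - s) 0)| ≤ 2 / ((k : ℝ) + 1)) ∧
    (∀ k s, |deriv (T k) s| ≤ L) ∧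
    ∀ (a : ℕ → ℝ) (b : ℝ), Tendsto a atTop (𝓝 b) → b ≠ m → b ≠ M →
      Tendsto (fun k => deriv (T k) (a k)) atTop (𝓝 (if b ∈ Icc m M then 0 else 1)) := by
  obtain ⟨τ, L, hsm, h0, hle, hL, hd0, hd1⟩ := exists_smooth_posPart
  set T : ℕ → ℝ → ℝ := fun k s =>
    ((k : ℝ) + 1)⁻¹ * (τ (((k : ℝ) + 1) * (s - M)) - τ (((k : ℝ) + 1) * (m - s))) with hT
  have hpos : ∀ k : ℕ, (0 : ℝ) < (k : ℝ) + 1 := fun k => by positivity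
  have hder : ∀ k s, deriv (T k) s
      = deriv τ (((k : ℝ) + 1) * (s - M)) + deriv τ (((k : ℝ) + 1) * (m - s)) := by
    intro k s
    have hτd : ∀ r, HasDerivAt τ (deriv τ r) r := fun r =>
      (hsm.differentiable (by simp) r).hasDerivAt
    have e1 : HasDerivAt (fun s => ((k : ℝ) + 1) * (s - M)) ((k : ℝ) + 1) s := by
      simpa using ((hasDerivAt_id s).sub_const M).const_mul ((k : ℝ) + 1)
    have e2 : HasDerivAt (fun s => ((k : ℝ) + 1) * (m - s)) (-((k : ℝ) + 1)) s := by
      simpa using ((hasDerivAt_id s).const_sub m).const_mul ((k : ℝ) + 1)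
    have e3 := (((hτd _).comp s e1).sub ((hτd _).comp s e2)).const_mul ((k : ℝ) + 1)⁻¹
    refine HasDerivAt.deriv (HasDerivAt.congr_deriv e3 ?_)
    have := (hpos k).ne'
    field_simp
    ring
  have hmaxmul : ∀ k : ℕ, ∀ s : ℝ, ((k : ℝ) + 1)⁻¹ * max (((k : ℝ) + 1) * s) 0 = max s 0 := by
    intro k s
    rw [mul_max_of_nonneg _ _ (inv_nonneg.2 (hpos k).le), mul_zero,
      inv_mul_cancel_left₀ (hpos k).ne']
  have hlim : ∀ (a : ℕ → ℝ) (b : ℝ), Tendsto a atTop (𝓝 b) → b ≠ 0 →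
      ∀ᶠ k : ℕ in atTop, deriv τ (((k : ℝ) + 1) * a k) = if 0 < b then 1 else 0 := by
    intro a b hab hb
    have hk : Tendsto (fun k : ℕ => (k : ℝ) + 1) atTop atTop :=
      tendsto_atTop_add_const_right _ _ tendsto_natCast_atTop_atTop
    rcases lt_or_gt_of_ne hb with hb | hb
    · filter_upwards [(hk.atTop_mul_neg hb hab).eventually_lt_atBot 0] with k hk0
      rw [hd0 _ hk0, if_neg hb.not_gt]
    · filter_upwards [(hk.atTop_mul_pos hb hab).eventually_gt_atTop 1] with k hk0
      rw [hd1 _ hk0, if_pos hb]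
  refine ⟨T, 2 * L, fun k => ?_, fun k s hs => ?_, fun k s => ?_, fun k s => ?_,
    fun a b hab hbm hbM => ?_⟩
  · exact contDiff_const.mul ((hsm.comp (contDiff_const.mul (contDiff_id.sub contDiff_const))).sub
      (hsm.comp (contDiff_const.mul (contDiff_const.sub contDiff_id))))
  · simp only [hT]
    rw [h0 _ (mul_nonpos_of_nonneg_of_nonpos (hpos k).le (by linarith [hs.2])),
      h0 _ (mul_nonpos_of_nonneg_of_nonpos (hpos k).le (by linarith [hs.1]))]
    simp
  · rw [← hmaxmul k (s - M), ← hmaxmul k (m - s), ← mul_sub, ← mul_sub, abs_mul,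
      abs_of_pos (inv_pos.2 (hpos k)), div_eq_inv_mul]
    refine mul_le_mul_of_nonneg_left ?_ (inv_nonneg.2 (hpos k).le)
    have e1 := abs_le.1 (hle (((k : ℝ) + 1) * (s - M)))
    have e2 := abs_le.1 (hle (((k : ℝ) + 1) * (m - s)))
    rw [abs_le]
    constructor <;> linarith [e1.1, e1.2, e2.1, e2.2]
  · rw [hder]
    have e1 := hL (((k : ℝ) + 1) * (s - M))
    have e2 := hL (((k : ℝ) + 1) * (m - s))
    exact (abs_add_le _ _).trans (by linarith)
  · refine tendsto_const_nhds.congr' ?_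
    filter_upwards [hlim (fun k => a k - M) (b - M) (hab.sub_const M) (sub_ne_zero.2 hbM),
      hlim (fun k => m - a k) (m - b) (hab.const_sub m) (sub_ne_zero.2 hbm.symm)] with k h1 h2
    rw [hder, h1, h2]
    simp only [sub_pos, mem_Icc]
    split_ifs with c1 c2 c3 c4 c5 <;> norm_num
    all_goals (exfalso; rcases lt_or_gt_of_ne hbm with h | h <;> rcases lt_or_gt_of_ne hbM with h' | h' <;> grind)

variable {n : ℕ} {B : Set (Euc n)}

lemma tendsto_integral_mul_of_tsupport_subset (hB : MeasurableSet B) {f : Euc n → ℝ}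
    {F : ℕ → Euc n → ℝ} (hf : IntegrableOn f B) (hF : ∀ k, Continuous (F k))
    (hlim : Tendsto (fun k => ∫⁻ x in B, ‖F k x - f x‖ₑ) atTop (𝓝 0))
    {χ : Euc n → ℝ} (hχ : Continuous χ) (hχc : HasCompactSupport χ) (hχB : tsupport χ ⊆ B) :
    Tendsto (fun k => ∫ x, F k x * χ x) atTop (𝓝 (∫ x, f x * χ x)) := by
  obtain ⟨C, hC⟩ := hχc.exists_bound_of_continuous hχ
  have hfint := integrable_mul_of_tsupport_subset hf.locallyIntegrableOn hχ hχc hχB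
  refine tendsto_integral_of_L1 _ hfint.aestronglyMeasurable (Eventually.of_forall fun k =>
    integrable_mul_of_tsupport_subset (Ω := univ)
      ((hF k).locallyIntegrable.locallyIntegrableOn _) hχ hχc (subset_univ _)) ?_
  have hle : ∀ k, ∫⁻ x, ‖F k x * χ x - f x * χ x‖ₑ
      ≤ ENNReal.ofReal C * ∫⁻ x in B, ‖F k x - f x‖ₑ := by
    intro k
    rw [← lintegral_const_mul' _ _ ENNReal.ofReal_ne_top, ← lintegral_indicator hB]
    refine lintegral_mono fun x => ?_
    by_cases hx : x ∈ B
    · rw [indicator_of_mem hx, ← sub_mul, enorm_mul, mul_comm]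
      gcongr
      rw [← ofReal_norm]
      exact ENNReal.ofReal_le_ofReal (hC x)
    · rw [image_eq_zero_of_notMem_tsupport fun h => hx (hχB h)]
      simp
  have hz := ENNReal.Tendsto.const_mul hlim (Or.inr (ENNReal.ofReal_ne_top (r := C)))
  rw [mul_zero] at hz
  exact tendsto_of_tendsto_of_tendsto_of_le_of_le tendsto_const_nhds hz (fun _ => zero_le) hle

/-- Weak gradients are stable under convergence in `W^{1,1}`. -/
lemma isWeakGradOn_of_tendsto (hB : MeasurableSet B) {v : Euc n → ℝ} {h : Euc n → Euc n}
    {φ : ℕ → Euc n → ℝ} (hv : IntegrableOn v B) (hh : IntegrableOn h B)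
    (hφ : ∀ k, ContDiff ℝ (⊤ : ℕ∞) (φ k))
    (h1 : Tendsto (fun k => ∫⁻ x in B, ‖φ k x - v x‖ₑ) atTop (𝓝 0))
    (h2 : Tendsto (fun k => ∫⁻ x in B, ‖gradient (φ k) x - h x‖ₑ) atTop (𝓝 0)) :
    IsWeakGradOn B v h := by
  refine ⟨hv.locallyIntegrableOn, (IntegrableOn.locallyIntegrableOn hh.norm), ?_⟩
  intro ψ hψ hψc hψB i
  have hψ' : Continuous fun x => fderiv ℝ ψ x (EuclideanSpace.single i 1) :=
    (hψ.continuous_fderiv (by simp)).clm_apply continuous_const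
  have hsub := tsupport_fderiv_apply_subset ℝ (f := ψ) (EuclideanSpace.single i (1 : ℝ))
  have hφ' : ∀ k, Continuous fun x => gradient (φ k) x i := fun k => by
    simp only [gradient_apply]
    exact ((hφ k).continuous_fderiv (by simp)).clm_apply continuous_const
  have hi : IntegrableOn (fun x => h x i) B :=
    (EuclideanSpace.proj i : Euc n →L[ℝ] ℝ).integrable_comp hh
  have t1 := tendsto_integral_mul_of_tsupport_subset hB hv (fun k => (hφ k).continuous) h1
    hψ' (hψc.of_isClosed_subset (isClosed_tsupport _) hsub) (hsub.trans hψB)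
  have t2 := tendsto_integral_mul_of_tsupport_subset hB hi hφ'
    (tendsto_of_tendsto_of_tendsto_of_le_of_le tendsto_const_nhds h2 (fun _ => zero_le)
      (fun k => lintegral_mono fun x => by
        rw [← ofReal_norm, ← ofReal_norm]
        exact ENNReal.ofReal_le_ofReal (PiLp.norm_apply_le (gradient (φ k) x - h x) i)))
    hψ.continuous hψc hψB
  refine tendsto_nhds_unique t1 ((t2.neg).congr fun k => ?_)
  simp only [gradient_apply]
  rw [integral_mul_fderiv_eq_neg_fderiv_mul_of_integrable]
  · simp only [← gradient_apply]
    exact integrable_mul_of_tsupport_subset (Ω := univ)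
      ((hφ' k).locallyIntegrable.locallyIntegrableOn _) hψ.continuous hψc (subset_univ _)
  · exact integrable_mul_fderiv (Ω := univ)
      ((hφ k).continuous.locallyIntegrable.locallyIntegrableOn _) hψ hψc (subset_univ _) _
  · exact integrable_mul_of_tsupport_subset (Ω := univ)
      ((hφ k).continuous.locallyIntegrable.locallyIntegrableOn _) hψ.continuous hψc (subset_univ _)
  · exact fun x _ => (hφ k).differentiable (by simp) x
  · exact fun x _ => hψ.differentiable (by simp) x

lemma memW110_of_tendsto (hB : MeasurableSet B) {v : Euc n → ℝ} {h : Euc n → Euc n}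
    {φ : ℕ → Euc n → ℝ} (hv : IntegrableOn v B) (hh : IntegrableOn h B)
    (hφ : ∀ k, ContDiff ℝ (⊤ : ℕ∞) (φ k) ∧ HasCompactSupport (φ k) ∧ tsupport (φ k) ⊆ B)
    (h1 : Tendsto (fun k => ∫⁻ x in B, ‖φ k x - v x‖ₑ) atTop (𝓝 0))
    (h2 : Tendsto (fun k => ∫⁻ x in B, ‖gradient (φ k) x - h x‖ₑ) atTop (𝓝 0)) :
    MemW110 B v := by
  refine ⟨h, isWeakGradOn_of_tendsto hB hv hh (fun k => (hφ k).1) h1 h2, φ, hφ, ?_⟩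
  rw [tendsto_zero_iff_enorm_tendsto_zero]
  have h3 := h1.add h2
  rw [add_zero] at h3
  refine tendsto_of_tendsto_of_tendsto_of_le_of_le tendsto_const_nhds h3 (fun _ => zero_le)
    fun k => ?_
  refine (enorm_integral_le_lintegral_enorm _).trans ?_
  have hm : AEMeasurable (fun x => ‖φ k x - v x‖ₑ) (volume.restrict B) :=
    ((hφ k).1.continuous.aestronglyMeasurable.sub hv.aestronglyMeasurable).enorm
  rw [← lintegral_add_left' hm]
  refine lintegral_mono fun x => (enorm_add_le _ _).trans ?_
  rw [← Real.norm_eq_abs, enorm_norm, enorm_norm]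

end Truncation

section Truncation

variable {n : ℕ}

lemma notMem_tsupport_indicator_ball {x₀ : Euc n} {ρ : ℝ} {f : Euc n → ℝ}
    (hf : ∀ x ∈ sphere x₀ ρ, f =ᶠ[𝓝 x] 0) {x : Euc n} (hx : x ∉ ball x₀ ρ) :
    (ball x₀ ρ).indicator f =ᶠ[𝓝 x] 0 := by
  rcases eq_or_ne (dist x x₀) ρ with h | h
  · filter_upwards [hf x h] with y hy
    by_cases hyB : y ∈ ball x₀ ρ
    · rw [indicator_of_mem hyB, hy]
    · rw [indicator_of_notMem hyB]; rfl
  · have hx' : x ∈ (closedBall x₀ ρ)ᶜ := fun hc =>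
      hx (lt_of_le_of_ne hc h)
    filter_upwards [isClosed_closedBall.isOpen_compl.mem_nhds hx'] with y hy
    rw [indicator_of_notMem fun hyB => hy (ball_subset_closedBall hyB)]; rfl

lemma contDiff_indicator_ball {x₀ : Euc n} {ρ : ℝ} {f : Euc n → ℝ}
    (hfs : ContDiff ℝ (⊤ : ℕ∞) f) (hf : ∀ x ∈ sphere x₀ ρ, f =ᶠ[𝓝 x] 0) :
    ContDiff ℝ (⊤ : ℕ∞) ((ball x₀ ρ).indicator f) ∧
      HasCompactSupport ((ball x₀ ρ).indicator f) ∧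
      tsupport ((ball x₀ ρ).indicator f) ⊆ ball x₀ ρ := by
  have hsub : tsupport ((ball x₀ ρ).indicator f) ⊆ ball x₀ ρ := fun x hx => by
    by_contra hxB
    exact notMem_tsupport_iff_eventuallyEq.2 (notMem_tsupport_indicator_ball hf hxB) hx
  refine ⟨contDiff_iff_contDiffAt.2 fun x => ?_, ?_, hsub⟩
  · by_cases hx : x ∈ ball x₀ ρ
    · refine hfs.contDiffAt.congr_of_eventuallyEq ?_
      filter_upwards [isOpen_ball.mem_nhds hx] with y hy using indicator_of_mem hy f
    · exact contDiffAt_const.congr_of_eventuallyEq (notMem_tsupport_indicator_ball hf hx)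
  · exact (isCompact_closedBall x₀ ρ).of_isClosed_subset (isClosed_tsupport _)
      (hsub.trans ball_subset_closedBall)

lemma gradient_comp {T : ℝ → ℝ} {U : Euc n → ℝ} {x : Euc n} (hT : DifferentiableAt ℝ T (U x))
    (hU : DifferentiableAt ℝ U x) :
    gradient (T ∘ U) x = deriv T (U x) • gradient U x := by
  simp only [gradient]
  rw [(hT.hasDerivAt.comp_hasFDerivAt x hU.hasFDerivAt).fderiv, map_smul]

/-- The truncation of a limit of smooth functions has zero boundary values on a ball if the
approximations take values in `(m, M)` on the sphere. -/
theorem memW110_truncation {x₀ : Euc n} {ρ : ℝ} {u : Euc n → ℝ} {g : Euc n → Euc n}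
    (hu : IntegrableOn u (ball x₀ ρ)) (hg : IntegrableOn g (ball x₀ ρ))
    {U : ℕ → Euc n → ℝ} (hU : ∀ k, ContDiff ℝ (⊤ : ℕ∞) (U k))
    (h1 : Tendsto (fun k => ∫⁻ x in ball x₀ ρ, ‖U k x - u x‖ₑ) atTop (𝓝 0))
    (h2 : Tendsto (fun k => ∫⁻ x in ball x₀ ρ, ‖gradient (U k) x - g x‖ₑ) atTop (𝓝 0))
    (hae : ∀ᵐ x ∂volume.restrict (ball x₀ ρ), Tendsto (fun k => U k x) atTop (𝓝 (u x)))
    {m M : ℝ} (hmM : m ≤ M) (hm : ∀ᵐ x ∂volume.restrict (ball x₀ ρ), u x ≠ m)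
    (hM : ∀ᵐ x ∂volume.restrict (ball x₀ ρ), u x ≠ M)
    (hS : ∀ k, ∀ x ∈ sphere x₀ ρ, U k x ∈ Ioo m M) :
    MemW110 (ball x₀ ρ) fun x => max (u x - M) 0 - max (m - u x) 0 := by
  classical
  set B := ball x₀ ρ
  have hBf : volume B ≠ ∞ := measure_ball_lt_top.ne
  have : IsFiniteMeasure (volume.restrict B) := ⟨by simpa using measure_ball_lt_top⟩
  obtain ⟨T, L, hTs, hT0, hTle, hTL, hTlim⟩ := exists_smooth_truncation m M hmM
  have hL0 : 0 ≤ L := (abs_nonneg _).trans (hTL 0 0)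
  set S : ℝ → ℝ := fun s => max (s - M) 0 - max (m - s) 0
  have hScont : Continuous S := by fun_prop
  have hSlip : ∀ s t, |S s - S t| ≤ 2 * |s - t| := fun s t => by
    have e1 := abs_max_sub_max_le_abs (s - M) (t - M) 0
    have e2 := abs_max_sub_max_le_abs (m - s) (m - t) 0
    rw [sub_sub_sub_cancel_right] at e1
    rw [show m - s - (m - t) = t - s by ring, abs_sub_comm t s] at e2
    have e3 : S s - S t = (max (s - M) 0 - max (t - M) 0)
        - (max (m - s) 0 - max (m - t) 0) := by simp only [S]; ring
    rw [e3]
    exact (abs_sub _ _).trans (by linarith)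
  set a : Euc n → ℝ := fun x => if u x ∈ Icc m M then 0 else 1 with ha
  have hum : AEMeasurable u (volume.restrict B) := hu.aestronglyMeasurable.aemeasurable
  have ham : AEStronglyMeasurable a (volume.restrict B) :=
    ((Measurable.ite measurableSet_Icc measurable_const measurable_const :
      Measurable fun s : ℝ => if s ∈ Icc m M then (0 : ℝ) else 1).comp_aemeasurable
        hum).aestronglyMeasurable
  have ha1 : ∀ x, |a x| ≤ 1 := fun x => by simp only [ha]; split_ifs <;> simp
  have hv : IntegrableOn (fun x => S (u x)) B := by
    refine Integrable.mono' ((hu.norm.const_mul 2).add (integrable_const |S 0|))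
      (hScont.comp_aestronglyMeasurable hu.aestronglyMeasurable) (ae_of_all _ fun x => ?_)
    have := hSlip (u x) 0
    rw [sub_zero] at this
    have h3 := abs_sub_abs_le_abs_sub (S (u x)) (S 0)
    simp only [Real.norm_eq_abs, Pi.add_apply]
    linarith
  have hh : IntegrableOn (fun x => a x • g x) B := by
    refine Integrable.mono' hg.norm (ham.smul hg.aestronglyMeasurable) (ae_of_all _ fun x => ?_)
    rw [norm_smul]
    exact mul_le_of_le_one_left (norm_nonneg _) (ha1 x)
  have hzero : ∀ k, ∀ x ∈ sphere x₀ ρ, (T k ∘ U k) =ᶠ[𝓝 x] 0 := fun k x hx => by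
    filter_upwards [(hU k).continuous.continuousAt.preimage_mem_nhds
      (isOpen_Ioo.mem_nhds (hS k x hx))] with y hy
    exact hT0 k _ (Ioo_subset_Icc_self hy)
  refine memW110_of_tendsto measurableSet_ball (φ := fun k => B.indicator (T k ∘ U k)) hv hh
    (fun k => contDiff_indicator_ball ((hTs k).comp (hU k)) (hzero k)) ?_ ?_
  · have hle : ∀ k : ℕ, ∫⁻ x in B, ‖B.indicator (T k ∘ U k) x - S (u x)‖ₑ
        ≤ ENNReal.ofReal (2 / ((k : ℝ) + 1)) * volume B
          + 2 * ∫⁻ x in B, ‖U k x - u x‖ₑ := by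
      intro k
      rw [← lintegral_const_mul' _ _ (by norm_num), ← setLIntegral_const,
        ← lintegral_add_left measurable_const]
      refine setLIntegral_mono' measurableSet_ball fun x hx => ?_
      rw [indicator_of_mem hx, Function.comp_apply,
        show T k (U k x) - S (u x) = (T k (U k x) - S (U k x)) + (S (U k x) - S (u x)) by ring]
      refine (enorm_add_le _ _).trans (add_le_add ?_ ?_)
      · rw [← ofReal_norm]
        exact ENNReal.ofReal_le_ofReal (hTle k _)
      · rw [← ofReal_norm, ← ofReal_norm, ← ENNReal.ofReal_ofNat 2,
          ← ENNReal.ofReal_mul zero_le_two]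
        exact ENNReal.ofReal_le_ofReal (hSlip _ _)
    have t1 : Tendsto (fun k : ℕ => ENNReal.ofReal (2 / ((k : ℝ) + 1)) * volume B)
        atTop (𝓝 0) := by
      have e1 : Tendsto (fun k : ℕ => 2 / ((k : ℝ) + 1)) atTop (𝓝 0) :=
        tendsto_const_nhds.div_atTop
          (tendsto_atTop_add_const_right _ _ tendsto_natCast_atTop_atTop)
      have e2 := ENNReal.tendsto_ofReal e1
      rw [ENNReal.ofReal_zero] at e2
      simpa using ENNReal.Tendsto.mul_const e2 (Or.inr hBf)
    have t2 := ENNReal.Tendsto.const_mul h1 (Or.inr (by norm_num : (2 : ℝ≥0∞) ≠ ∞))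
    have t3 := t1.add t2
    simp only [mul_zero, add_zero] at t3
    exact tendsto_of_tendsto_of_tendsto_of_le_of_le tendsto_const_nhds t3 (fun _ => zero_le) hle
  · have hmA : ∀ k, AEMeasurable (fun x => ‖(deriv (T k) (U k x) - a x) • g x‖ₑ)
        (volume.restrict B) := fun k =>
      ((((((hTs k).continuous_deriv (by simp)).comp
        (hU k).continuous).aestronglyMeasurable).sub ham).smul hg.aestronglyMeasurable).enorm
    have hle : ∀ k : ℕ, ∫⁻ x in B, ‖gradient (B.indicator (T k ∘ U k)) x - a x • g x‖ₑ
        ≤ ENNReal.ofReal L * (∫⁻ x in B, ‖gradient (U k) x - g x‖ₑ)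
          + ∫⁻ x in B, ‖(deriv (T k) (U k x) - a x) • g x‖ₑ := by
      intro k
      rw [← lintegral_const_mul' _ _ ENNReal.ofReal_ne_top, ← lintegral_add_right' _ (hmA k)]
      refine setLIntegral_mono' measurableSet_ball fun x hx => ?_
      have hgr : gradient (B.indicator (T k ∘ U k)) x = gradient (T k ∘ U k) x := by
        simp only [gradient]
        rw [Filter.EventuallyEq.fderiv_eq]
        filter_upwards [isOpen_ball.mem_nhds hx] with y hy using indicator_of_mem hy _
      rw [hgr, gradient_comp ((hTs k).differentiable (by simp) _)
        ((hU k).differentiable (by simp) x),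
        show deriv (T k) (U k x) • gradient (U k) x - a x • g x
          = deriv (T k) (U k x) • (gradient (U k) x - g x)
            + (deriv (T k) (U k x) - a x) • g x by rw [smul_sub, sub_smul]; abel]
      refine (enorm_add_le _ _).trans (add_le_add ?_ le_rfl)
      rw [enorm_smul]
      gcongr
      rw [← ofReal_norm]
      exact ENNReal.ofReal_le_ofReal (hTL k _)
    have t1 := ENNReal.Tendsto.const_mul h2 (Or.inr (ENNReal.ofReal_ne_top (r := L)))
    have t2 : Tendsto (fun k => ∫⁻ x in B, ‖(deriv (T k) (U k x) - a x) • g x‖ₑ)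
        atTop (𝓝 (∫⁻ x in B, 0)) := by
      refine tendsto_lintegral_of_dominated_convergence'
        (fun x => ENNReal.ofReal (L + 1) * ‖g x‖ₑ) hmA (fun k => ae_of_all _ fun x => ?_) ?_ ?_
      · dsimp only
        rw [enorm_smul]
        gcongr
        rw [← ofReal_norm]
        exact ENNReal.ofReal_le_ofReal ((abs_sub _ _).trans (add_le_add (hTL k _) (ha1 x)))
      · rw [lintegral_const_mul' _ _ ENNReal.ofReal_ne_top]
        exact ENNReal.mul_ne_top ENNReal.ofReal_ne_top hg.2.ne
      · filter_upwards [hae, hm, hM] with x hx hxm hxM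
        have e1 := (hTlim _ _ hx hxm hxM).sub_const (a x)
        rw [show (if u x ∈ Icc m M then (0 : ℝ) else 1) - a x = 0 from sub_self _] at e1
        have e2 := e1.smul_const (g x)
        rw [zero_smul] at e2
        exact tendsto_zero_iff_enorm_tendsto_zero.1 e2
    have t3 := t1.add t2
    simp only [mul_zero, add_zero, lintegral_zero] at t3
    exact tendsto_of_tendsto_of_tendsto_of_le_of_le tendsto_const_nhds t3 (fun _ => zero_le) hle

end Truncation

section SphereOscillation

variable {n : ℕ} {Ω : Set (Euc n)} {u : Euc n → ℝ} {g : Euc n → Euc n}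

lemma enorm_mollify_rpow_le_add (φ : ContDiffBump (0 : Euc n)) {f : Euc n → Euc n}
    (hf : Measurable f) {p : ℝ} (hp : 1 ≤ p) (hfint : Integrable fun x => ‖f x‖ ^ p) (x : Euc n) :
    ‖mollify φ f x‖ₑ ^ p
      ≤ ‖f x‖ₑ ^ p + ‖mollify φ (fun x => ‖f x‖ ^ p) x - ‖f x‖ ^ p‖ₑ := by
  have hp0 : 0 ≤ p := by linarith
  have henorm : ∀ y, ‖f y‖ₑ ^ p = ‖‖f y‖ ^ p‖ₑ := fun y => by
    rw [Real.enorm_rpow_of_nonneg (norm_nonneg _) hp0, enorm_norm]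
  refine (enorm_mollify_rpow_le φ hf.enorm hp x).trans ?_
  have hce : Integrable fun t => φ.normed volume t • ‖f (x - t)‖ ^ p :=
    (φ.hasCompactSupport_normed (μ := volume)).convolutionExists_left (lsmul ℝ ℝ)
      φ.continuous_normed hfint.locallyIntegrable x
  have hnn : ∀ t, 0 ≤ φ.normed volume t • ‖f (x - t)‖ ^ p := fun t =>
    mul_nonneg (φ.nonneg_normed t) (Real.rpow_nonneg (norm_nonneg _) _)
  have h1 : ∫⁻ t, ‖φ.normed volume t‖ₑ * ‖f (x - t)‖ₑ ^ p
      = ‖mollify φ (fun x => ‖f x‖ ^ p) x‖ₑ := by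
    rw [mollify_apply, Real.enorm_of_nonneg (integral_nonneg hnn),
      ofReal_integral_eq_lintegral_ofReal hce (ae_of_all _ hnn)]
    refine lintegral_congr fun t => ?_
    rw [← Real.enorm_of_nonneg (hnn t), enorm_smul, henorm]
  rw [h1, henorm]
  have h2 : mollify φ (fun x => ‖f x‖ ^ p) x = ‖f x‖ ^ p
      + (mollify φ (fun x => ‖f x‖ ^ p) x - ‖f x‖ ^ p) := by ring
  conv_lhs => rw [h2]
  exact enorm_add_le _ _

/-- Smooth approximations which converge in `W^{1,1}` on a ball, and whose gradients are
asymptotically controlled in `L^p` on almost every concentric sphere. -/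
theorem exists_smooth_approx (hn : n ≠ 0) {p : ℝ} (hp : 1 ≤ p) (hug : IsWeakGradOn Ω u g)
    (hgm : Measurable g) {x₀ : Euc n} {R R' : ℝ} (hR : closedBall x₀ R ⊆ Ω) (hRR : R' < R)
    (hgp : ∫⁻ x in closedBall x₀ R, ‖g x‖ₑ ^ p ≠ ∞) :
    ∃ U : ℕ → Euc n → ℝ, (∀ k, ContDiff ℝ (⊤ : ℕ∞) (U k)) ∧
      Tendsto (fun k => ∫⁻ x in ball x₀ R', ‖U k x - u x‖ₑ) atTop (𝓝 0) ∧
      Tendsto (fun k => ∫⁻ x in ball x₀ R', ‖gradient (U k) x - g x‖ₑ) atTop (𝓝 0) ∧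
      (∀ᵐ x, x ∈ closedBall x₀ R → Tendsto (fun k => U k x) atTop (𝓝 (u x))) ∧
      ∀ᵐ r ∂volume.restrict (Ioi (0 : ℝ)), r < R' → ∃ e : ℕ → ℝ≥0∞, Tendsto e atTop (𝓝 0) ∧
        ∀ k, sphereInt (fun x => ‖fderiv ℝ (U k) (x₀ + x)‖ₑ ^ p) r
          ≤ sphereInt (fun x => ‖g (x₀ + x)‖ₑ ^ p) r + e k := by
  have hp0 : 0 < p := by linarith
  set B := closedBall x₀ R
  have hBc : IsCompact B := isCompact_closedBall x₀ R
  have hBm : MeasurableSet B := measurableSet_closedBall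
  have hu : Integrable (B.indicator u) :=
    ((hug.1.mono_set hR).integrableOn_isCompact hBc).integrable_indicator hBm
  have hg : Integrable (B.indicator g) := by
    refine IntegrableOn.integrable_indicator ?_ hBm
    exact (integrable_norm_iff hgm.aestronglyMeasurable).1
      ((hug.2.1.mono_set hR).integrableOn_isCompact hBc)
  have hgim : Measurable (B.indicator g) := hgm.indicator hBm
  have hsubB : ball x₀ R' ⊆ B := ball_subset_closedBall.trans (closedBall_subset_closedBall hRR.le)
  set P : Euc n → ℝ := fun x => ‖B.indicator g x‖ ^ p with hP
  have hPm : Measurable P := hgim.norm.pow_const p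
  have hPe : ∀ x, ‖P x‖ₑ = B.indicator (fun x => ‖g x‖ₑ ^ p) x := by
    intro x
    simp only [hP]
    rw [Real.enorm_rpow_of_nonneg (norm_nonneg _) hp0.le, enorm_norm]
    by_cases hx : x ∈ B
    · simp [hx]
    · simp [hx, hp0]
  have hPi : Integrable P := by
    refine ⟨hPm.aestronglyMeasurable, ?_⟩
    rw [HasFiniteIntegral, lintegral_congr hPe, lintegral_indicator hBm]
    exact hgp.lt_top
  let φ : ℕ → ContDiffBump (0 : Euc n) := fun k =>
    ⟨1 / (2 * ((k : ℝ) + 1)), 1 / ((k : ℝ) + 1), by positivity, by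
      apply one_div_lt_one_div_of_lt <;> linarith [(Nat.cast_nonneg k : (0 : ℝ) ≤ k)]⟩
  have hφ : Tendsto (fun k => (φ k).rOut) atTop (𝓝 0) := tendsto_one_div_add_atTop_nhds_zero_nat
  set E : ℕ → Euc n → ℝ≥0∞ := fun k x => ‖mollify (φ k) P x - P x‖ₑ
  have hEm : ∀ k, Measurable (E k) := fun k =>
    ((continuous_mollify (φ k) hPi.locallyIntegrable).measurable.sub hPm).enorm
  have hE : Tendsto (fun k => ∫⁻ x, E k x) atTop (𝓝 0) := tendsto_lintegral_mollify_sub hφ hPi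
  have hev : ∀ j : ℕ, ∃ N, ∀ k ≥ N, (φ k).rOut ≤ R - R' ∧ ∫⁻ x, E k x ≤ 2⁻¹ ^ j := fun j => by
    rw [← eventually_atTop]
    refine (hφ.eventually_le_const (sub_pos.2 hRR)).and (hE.eventually_le_const ?_)
    exact ENNReal.pow_pos (by simp) j
  obtain ⟨s, hs, hsP⟩ := extraction_forall_of_eventually' hev
  have hst := hs.tendsto_atTop
  have hgr : ∀ k, ∀ x ∈ closedBall x₀ R',
      gradient (mollify (φ (s k)) (B.indicator u)) x = mollify (φ (s k)) (B.indicator g) x :=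
    fun k x hx => gradient_mollify_indicator hug hgm hR (φ (s k)) (by
      have := mem_closedBall.1 hx
      linarith [(hsP k).1])
  refine ⟨fun k => mollify (φ (s k)) (B.indicator u),
    fun k => contDiff_mollify _ hu.locallyIntegrable, ?_, ?_, ?_, ?_⟩
  · refine tendsto_of_tendsto_of_tendsto_of_le_of_le tendsto_const_nhds
      ((tendsto_lintegral_mollify_sub hφ hu).comp hst) (fun _ => zero_le) fun k => ?_
    refine le_trans ?_ (setLIntegral_le_lintegral (ball x₀ R') _)
    refine setLIntegral_mono' measurableSet_ball fun x hx => ?_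
    rw [indicator_of_mem (hsubB hx)]
  · refine tendsto_of_tendsto_of_tendsto_of_le_of_le tendsto_const_nhds
      ((tendsto_lintegral_mollify_sub hφ hg).comp hst) (fun _ => zero_le) fun k => ?_
    refine le_trans ?_ (setLIntegral_le_lintegral (ball x₀ R') _)
    refine setLIntegral_mono' measurableSet_ball fun x hx => ?_
    rw [indicator_of_mem (hsubB hx), hgr k x (ball_subset_closedBall hx)]
  · have hK : ∀ᶠ k in atTop, (φ k).rOut ≤ 2 * (φ k).rIn := Eventually.of_forall fun k => by
      change 1 / ((k : ℝ) + 1) ≤ 2 * (1 / (2 * ((k : ℝ) + 1)))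
      apply le_of_eq
      field_simp
    filter_upwards [ContDiffBump.ae_convolution_tendsto_right_of_locallyIntegrable hφ hK
      hu.locallyIntegrable] with x hx hxB
    rw [indicator_of_mem hxB] at hx
    exact hx.comp hst
  · set W : Euc n → ℝ≥0∞ := fun x => ∑' k, E (s k) (x₀ + x)
    have hEm' : ∀ k, Measurable fun x => E (s k) (x₀ + x) := fun k =>
      (hEm (s k)).comp (measurable_const_add x₀)
    have hWm : Measurable W := Measurable.tsum hEm'
    have hW : ∫⁻ x, W x ≠ ∞ := by
      rw [lintegral_tsum fun k => (hEm' k).aemeasurable]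
      refine ne_top_of_le_ne_top ?_ (ENNReal.tsum_le_tsum (g := fun k => 2⁻¹ ^ k) fun k => ?_)
      · rw [ENNReal.tsum_geometric]
        simp
      · rw [lintegral_add_left_eq_self (E (s k)) x₀]
        exact (hsP k).2
    rw [lintegral_polar hn hWm] at hW
    have hfin := ae_lt_top (((measurable_id.pow_const (n - 1)).ennreal_ofReal).mul
      (measurable_sphereInt hWm)) hW
    filter_upwards [hfin, ae_restrict_mem measurableSet_Ioi] with r hr hr0 hrR
    have hr0' : (0 : ℝ) < r := hr0
    have hWr : sphereInt W r ≠ ∞ := by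
      intro h
      rw [Pi.mul_apply, h, ENNReal.mul_top] at hr
      · exact hr.ne rfl
      · simpa using pow_pos hr0' _
    refine ⟨fun k => sphereInt (fun x => E (s k) (x₀ + x)) r, ?_, fun k => ?_⟩
    · refine ENNReal.tendsto_atTop_zero_of_tsum_ne_top ?_
      simp only [sphereInt]
      rw [← lintegral_tsum]
      · exact hWr
      · exact fun k => ((hEm' k).comp (by fun_prop)).aemeasurable
    · simp only [sphereInt]
      have hθm : Measurable fun θ : sphere (0 : Euc n) 1 => E (s k) (x₀ + r • (θ : Euc n)) :=
        (hEm (s k)).comp (by fun_prop)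
      rw [← lintegral_add_right _ hθm]
      refine lintegral_mono fun θ => ?_
      have hmem : x₀ + r • (θ : Euc n) ∈ closedBall x₀ R' := by
        rw [mem_closedBall, dist_self_add_left, norm_smul, norm_eq_of_mem_sphere, mul_one,
          Real.norm_of_nonneg hr0'.le]
        exact hrR.le
      have hmem' := closedBall_subset_closedBall hRR.le hmem
      have h1 : ‖fderiv ℝ (mollify (φ (s k)) (B.indicator u)) (x₀ + r • (θ : Euc n))‖ₑ
          = ‖mollify (φ (s k)) (B.indicator g) (x₀ + r • (θ : Euc n))‖ₑ := by
        rw [← hgr k _ hmem, ← ofReal_norm, ← ofReal_norm, norm_gradient]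
      dsimp only
      rw [h1]
      refine (enorm_mollify_rpow_le_add _ hgim hp hPi _).trans ?_
      have hPx : P (x₀ + r • (θ : Euc n)) = ‖g (x₀ + r • (θ : Euc n))‖ ^ p := by
        simp only [hP]
        rw [indicator_of_mem hmem']
      rw [indicator_of_mem hmem', ← hPx]

end SphereOscillation

section BallOscillation

variable {n : ℕ} {Ω : Set (Euc n)} {u : Euc n → ℝ} {g : Euc n → Euc n}

lemma sphereInt_comp_smul (F : Euc n → ℝ≥0∞) (r : ℝ) :
    sphereInt (fun x => F (r • x)) 1 = sphereInt F r := by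
  simp [sphereInt]

lemma sphereInt_const_mul {F : Euc n → ℝ≥0∞} (hF : Measurable F) (c : ℝ≥0∞) (r : ℝ) :
    sphereInt (fun x => c * F x) r = c * sphereInt F r := by
  simp only [sphereInt]
  exact lintegral_const_mul _ (hF.comp (by fun_prop))

/-- The Morrey estimate on spheres of arbitrary centre and radius. -/
lemma exists_sphere_morrey_scaled (hn : 2 ≤ n) {p : ℝ} (hp : (n : ℝ) - 1 < p) :
    ∃ C : ℝ≥0∞, C ≠ ∞ ∧ ∀ w : Euc n → ℝ, ContDiff ℝ 1 w → ∀ (x₀ : Euc n) (r : ℝ), 0 < r →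
      ∀ a ∈ sphere x₀ r, ∀ b ∈ sphere x₀ r,
        ‖w a - w b‖ₑ ≤ C * ENNReal.ofReal r *
          sphereInt (fun x => ‖fderiv ℝ w (x₀ + x)‖ₑ ^ p) r ^ (1 / p) := by
  obtain ⟨C, hC, h⟩ := exists_sphere_morrey hn hp
  have hp0 : 0 < p := by
    have : (2 : ℝ) ≤ n := by exact_mod_cast hn
    linarith
  refine ⟨C, hC, fun w hw x₀ r hr a ha b hb => ?_⟩
  have hW : ContDiff ℝ 1 fun x => w (x₀ + r • x) := hw.comp (by fun_prop)
  have hunit : ∀ y ∈ sphere x₀ r, ‖r⁻¹ • (y - x₀)‖ = 1 := fun y hy => by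
    rw [norm_smul, mem_sphere_iff_norm.1 hy, Real.norm_of_nonneg (inv_nonneg.2 hr.le),
      inv_mul_cancel₀ hr.ne']
  have hback : ∀ y, x₀ + r • (r⁻¹ • (y - x₀)) = y := fun y => by
    rw [smul_inv_smul₀ hr.ne']
    simp
  have hd : ∀ x, fderiv ℝ (fun x => w (x₀ + r • x)) x = r • fderiv ℝ w (x₀ + r • x) := fun x => by
    have h1 : HasFDerivAt (fun x : Euc n => x₀ + r • x) (r • ContinuousLinearMap.id ℝ (Euc n)) x :=
      ((hasFDerivAt_id x).const_smul r).const_add x₀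
    have h2 := ((hw.differentiable one_ne_zero (x₀ + r • x)).hasFDerivAt.comp x h1).fderiv
    rw [Function.comp_def] at h2
    rw [h2]
    ext v
    simp
  have hm : Measurable fun x => ‖fderiv ℝ w (x₀ + x)‖ₑ ^ p :=
    (((hw.continuous_fderiv one_ne_zero).comp (by fun_prop)).enorm.measurable).pow_const p
  have key := h _ hW _ _ (hunit a ha) (hunit b hb)
  simp only [hback] at key
  refine key.trans (le_of_eq ?_)
  have h3 : (fun x => ‖fderiv ℝ (fun x => w (x₀ + r • x)) x‖ₑ ^ p)
      = fun x => ENNReal.ofReal r ^ p * ‖fderiv ℝ w (x₀ + r • x)‖ₑ ^ p := by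
    funext x
    rw [hd, enorm_smul, ENNReal.mul_rpow_of_nonneg _ _ hp0.le, Real.enorm_of_nonneg hr.le]
  rw [h3, sphereInt_comp_smul (fun x => ENNReal.ofReal r ^ p * ‖fderiv ℝ w (x₀ + x)‖ₑ ^ p),
    sphereInt_const_mul hm, ENNReal.mul_rpow_of_nonneg _ _ (by positivity), ← ENNReal.rpow_mul,
    mul_one_div_cancel hp0.ne', ENNReal.rpow_one, mul_assoc]

/-- A level strictly between two bounds for which the two associated level sets are null. -/
lemma exists_level_ae_ne {s : Set (Euc n)} (hu : AEMeasurable u (volume.restrict s)) (c : ℝ)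
    {a b : ℝ} (ha : 0 ≤ a) (hab : a < b) :
    ∃ d, a < d ∧ d < b ∧ (∀ᵐ x ∂volume.restrict s, u x ≠ c - d) ∧
      ∀ᵐ x ∂volume.restrict s, u x ≠ c + d := by
  have hv : NullMeasurable (fun x => |u x - c|) (volume.restrict s) :=
    (measurable_norm.comp_aemeasurable (hu.sub_const c)).nullMeasurable
  obtain ⟨d, hd, had, hdb⟩ :=
    ((Measure.countable_meas_level_set_pos₀ hv).dense_compl ℝ).exists_between hab
  have hd0 : ∀ᵐ x ∂volume.restrict s, |u x - c| ≠ d := by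
    rw [ae_iff]
    simpa using hd
  refine ⟨d, had, hdb, ?_, ?_⟩
  · filter_upwards [hd0] with x hx h
    exact hx (by rw [h, show c - d - c = -d by ring, abs_neg, abs_of_nonneg (by linarith)])
  · filter_upwards [hd0] with x hx h
    exact hx (by rw [h, show c + d - c = d by ring, abs_of_nonneg (by linarith)])

/-- A weakly monotone function oscillates on almost every ball at most as much as the Morrey
estimate allows on the bounding sphere. -/
theorem exists_ae_osc_ball (hn : 2 ≤ n) {p : ℝ} (hp : (n : ℝ) - 1 < p) :
    ∃ C : ℝ≥0∞, C ≠ ∞ ∧ ∀ (Ω : Set (Euc n)) (u : Euc n → ℝ) (g : Euc n → Euc n),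
      IsWeakGradOn Ω u g → Measurable g → WeaklyMonotone Ω u →
      ∀ (x₀ : Euc n) (R R' : ℝ), closedBall x₀ R ⊆ Ω → R' < R →
      ∫⁻ x in closedBall x₀ R, ‖g x‖ₑ ^ p ≠ ∞ →
      ∀ᵐ r ∂volume.restrict (Ioi (0 : ℝ)), r < R' → ∀ δ : ℝ, 0 < δ →
        C * ENNReal.ofReal r * sphereInt (fun x => ‖g (x₀ + x)‖ₑ ^ p) r ^ (1 / p)
          < ENNReal.ofReal δ →
        ∃ c : ℝ, ∀ᵐ x ∂volume.restrict (ball x₀ r), |u x - c| ≤ 2 * δ := by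
  obtain ⟨C, hC, hmor⟩ := exists_sphere_morrey_scaled hn hp
  refine ⟨C, hC, fun Ω u g hug hgm hmon x₀ R R' hR hRR hgp => ?_⟩
  have hn2 : (2 : ℝ) ≤ n := by exact_mod_cast hn
  have hp1 : 1 ≤ p := by linarith
  have hn0 : n ≠ 0 := by omega
  obtain ⟨U, hU, hU1, hU2, hUae, hUr⟩ := exists_smooth_approx hn0 hp1 hug hgm hR hRR hgp
  have htr : ∀ᵐ x : Euc n, x₀ + x ∈ closedBall x₀ R →
      Tendsto (fun k => U k (x₀ + x)) atTop (𝓝 (u (x₀ + x))) :=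
    (measurePreserving_add_left volume x₀).quasiMeasurePreserving.ae hUae
  have : Nontrivial (Euc n) := by
    have : Nonempty (Fin n) := ⟨⟨0, by omega⟩⟩
    infer_instance
  filter_upwards [hUr, ae_ae_sphere hn0 htr, ae_restrict_mem measurableSet_Ioi]
    with r hr hrae hr0 hrR δ hδ hlt
  have hr0' : (0 : ℝ) < r := hr0
  obtain ⟨e, he, hle⟩ := hr hrR
  have : NeBot (ae (volume : Measure (Euc n)).toSphere) :=
    ae_neBot.2 (Measure.toSphere_ne_zero _)
  obtain ⟨θ, hθ⟩ := hrae.exists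
  have hsph : x₀ + r • (θ : Euc n) ∈ sphere x₀ r := by
    rw [mem_sphere, dist_self_add_left, norm_smul, norm_eq_of_mem_sphere, mul_one,
      Real.norm_of_nonneg hr0'.le]
  set b := x₀ + r • (θ : Euc n)
  have hsub : ball x₀ r ⊆ ball x₀ R' := ball_subset_ball hrR.le
  have hcl : closedBall x₀ r ⊆ closedBall x₀ R := closedBall_subset_closedBall (hrR.trans hRR).le
  have hθ' := hθ (hcl (sphere_subset_closedBall hsph))
  have huI : IntegrableOn u (ball x₀ r) :=
    ((hug.1.mono_set (hcl.trans hR)).integrableOn_isCompact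
      (isCompact_closedBall x₀ r)).mono_set ball_subset_closedBall
  have hgI : IntegrableOn g (ball x₀ r) := by
    refine (integrable_norm_iff hgm.aestronglyMeasurable).1 ?_
    exact ((hug.2.1.mono_set (hcl.trans hR)).integrableOn_isCompact
      (isCompact_closedBall x₀ r)).mono_set ball_subset_closedBall
  obtain ⟨d, hd1, hd2, hdm, hdM⟩ := exists_level_ae_ne huI.aestronglyMeasurable.aemeasurable (u b)
    hδ.le (show δ < 2 * δ by linarith)
  have hlim : Tendsto (fun k => C * ENNReal.ofReal r *
      (sphereInt (fun x => ‖g (x₀ + x)‖ₑ ^ p) r + e k) ^ (1 / p)) atTop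
      (𝓝 (C * ENNReal.ofReal r * sphereInt (fun x => ‖g (x₀ + x)‖ₑ ^ p) r ^ (1 / p))) := by
    refine ENNReal.Tendsto.const_mul ?_ (Or.inr (mul_ne_top hC ofReal_ne_top))
    refine Filter.Tendsto.ennrpow_const _ ?_
    simpa using tendsto_const_nhds.add he
  have hev : ∀ᶠ k in atTop, ∀ x ∈ sphere x₀ r, U k x ∈ Ioo (u b - d) (u b + d) := by
    filter_upwards [hlim.eventually_lt_const hlt,
      Metric.tendsto_nhds.1 hθ' (d - δ) (by linarith)] with k hk1 hk2 x hx
    have h1 : ‖U k x - U k b‖ₑ < ENNReal.ofReal δ := by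
      refine lt_of_le_of_lt (hmor (U k) ((hU k).of_le (by simp)) x₀ r hr0' x hx b hsph) ?_
      refine lt_of_le_of_lt ?_ hk1
      gcongr
      exact hle k
    rw [Real.enorm_eq_ofReal_abs, ENNReal.ofReal_lt_ofReal_iff hδ] at h1
    rw [Real.dist_eq] at hk2
    have h2 := abs_lt.1 h1
    have h3 := abs_lt.1 hk2
    constructor <;> linarith [h2.1, h2.2, h3.1, h3.2]
  obtain ⟨K, hK⟩ := eventually_atTop.1 hev
  have hshift : Tendsto (fun k : ℕ => k + K) atTop atTop := tendsto_add_atTop_nat K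
  have hmem : MemW110 (ball x₀ r) fun x => max (u x - (u b + d)) 0 - max (u b - d - u x) 0 := by
    refine memW110_truncation huI hgI (U := fun k => U (k + K)) (fun k => hU _) ?_ ?_ ?_
      (by linarith) hdm hdM fun k => hK _ (by omega)
    · exact tendsto_of_tendsto_of_tendsto_of_le_of_le tendsto_const_nhds (hU1.comp hshift)
        (fun _ => zero_le) fun k => lintegral_mono_set hsub
    · exact tendsto_of_tendsto_of_tendsto_of_le_of_le tendsto_const_nhds (hU2.comp hshift)
        (fun _ => zero_le) fun k => lintegral_mono_set hsub
    · filter_upwards [ae_restrict_of_ae hUae, ae_restrict_mem measurableSet_ball] with x hx hxb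
      exact (hx (hcl (ball_subset_closedBall hxb))).comp hshift
  have hclo : closure (ball x₀ r) ⊆ closedBall x₀ r := closure_ball_subset_closedBall
  refine ⟨u b, ?_⟩
  filter_upwards [hmon (ball x₀ r) isOpen_ball
    ((isCompact_closedBall x₀ r).of_isClosed_subset isClosed_closure hclo)
    (hclo.trans (hcl.trans hR)) _ _ (by linarith) hmem] with x hx
  rw [abs_le]
  constructor <;> linarith [hx.1, hx.2]

end BallOscillation

section Potential

variable {n : ℕ} {Ω : Set (Euc n)} {u : Euc n → ℝ} {g : Euc n → Euc n}

lemma lintegral_Ioo_inv_eq {σ : ℝ → ℝ} {c : ℝ} (hc : 0 < c) :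
    ∫⁻ r in Ioo 0 c⁻¹, (ENNReal.ofReal (r * σ (1 / r)))⁻¹
      = ∫⁻ t in Ioi c, (ENNReal.ofReal (t * σ t))⁻¹ := by
  have himg : (fun t : ℝ => t⁻¹) '' Ioi c = Ioo 0 c⁻¹ := by
    rw [image_inv_eq_inv, Set.inv_Ioi₀ hc]
  rw [← himg, lintegral_image_eq_lintegral_abs_deriv_mul measurableSet_Ioi
    (f' := fun t => -(t ^ 2)⁻¹) (fun t ht => (hasDerivAt_inv (hc.trans ht).ne').hasDerivWithinAt)
    (inv_injective.injOn)]
  refine setLIntegral_congr_fun measurableSet_Ioi fun t ht => ?_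
  have ht0 : 0 < t := hc.trans ht
  rw [abs_neg, abs_of_pos (by positivity), one_div, inv_inv,
    show t * σ t = t ^ 2 * (t⁻¹ * σ t) by field_simp,
    ENNReal.ofReal_mul (p := t ^ 2) (by positivity),
    ENNReal.mul_inv (a := ENNReal.ofReal (t ^ 2))
      (by left; simpa using ht0.ne') (by simp),
    ENNReal.ofReal_inv_of_pos (by positivity)]

lemma ofReal_mul_kernel {σ : ℝ → ℝ} {p r : ℝ} (hn : n ≠ 0) (hr : 0 < r) :
    ENNReal.ofReal (r ^ (n - 1)) *
        (ENNReal.ofReal (r ^ n) * ENNReal.ofReal (σ (1 / r) * (1 / r) ^ p))⁻¹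
      = ENNReal.ofReal r ^ p * (ENNReal.ofReal (r * σ (1 / r)))⁻¹ := by
  have hp : 0 < r ^ p := Real.rpow_pos_of_pos hr p
  have hpow : r ^ n = r ^ (n - 1) * r := by rw [← pow_succ, Nat.sub_one_add_one hn]
  have hq : 0 < r ^ (n - 1) := pow_pos hr _
  rw [← ENNReal.ofReal_mul (by positivity), Real.div_rpow zero_le_one hr.le, Real.one_rpow, hpow,
    show r ^ (n - 1) * r * (σ (1 / r) * (1 / r ^ p))
      = (r ^ (n - 1) * (r ^ p)⁻¹) * (r * σ (1 / r)) by field_simp,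
    ENNReal.ofReal_mul (p := r ^ (n - 1) * (r ^ p)⁻¹) (by positivity),
    ENNReal.mul_inv (by left; simpa using by positivity) (by simp),
    ← ENNReal.ofReal_inv_of_pos (by positivity), ← mul_assoc, ← ENNReal.ofReal_mul hq.le,
    ENNReal.ofReal_rpow_of_pos hr]
  congr 2
  field_simp

/-- The filter of neighbourhoods of a point, up to null sets. -/
def nhdsAE (x : Euc n) : Filter (Euc n) := 𝓝 x ⊓ ae volume

lemma eventually_nhdsAE_of_ball {x : Euc n} {r : ℝ} (hr : 0 < r) {P : Euc n → Prop}
    (h : ∀ᵐ y ∂volume.restrict (ball x r), P y) : ∀ᶠ y in nhdsAE x, P y := by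
  rw [ae_restrict_iff' measurableSet_ball] at h
  rw [nhdsAE]
  filter_upwards [mem_inf_of_left (ball_mem_nhds x hr), mem_inf_of_right h] with y h1 h2
  exact h2 h1

instance nhdsAE_neBot (x : Euc n) : NeBot (nhdsAE x) := by
  refine inf_neBot_iff.2 fun {s} hs {t} ht => ?_
  by_contra h
  rw [not_nonempty_iff_eq_empty, ← disjoint_iff_inter_eq_empty] at h
  have h1 : volume s = 0 := measure_mono_null h.subset_compl_right (by simpa [mem_ae_iff] using ht)
  exact (Measure.measure_pos_of_mem_nhds volume hs).ne' h1

/-- The points at which the function has no approximate limit in the essential sense. -/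
def essDiscontinuitySet (u : Euc n → ℝ) : Set (Euc n) := {x | ¬ Cauchy (map u (nhdsAE x))}

lemma exists_forall_not_ae_of_mem_essDiscontinuitySet {x : Euc n}
    (hx : x ∈ essDiscontinuitySet u) :
    ∃ δ : ℝ, 0 < δ ∧ ∀ r, 0 < r → ∀ c, ¬ ∀ᵐ y ∂volume.restrict (ball x r), |u y - c| ≤ 2 * δ := by
  by_contra! h
  refine hx (Metric.cauchy_iff.2 ⟨inferInstance, fun ε hε => ?_⟩)
  obtain ⟨r, hr, c, hc⟩ := h (ε / 8) (by positivity)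
  refine ⟨_, image_mem_map (eventually_nhdsAE_of_ball hr hc), ?_⟩
  rintro _ ⟨y, hy, rfl⟩ _ ⟨z, hz, rfl⟩
  have h1 := abs_le.1 (show |u y - c| ≤ 2 * (ε / 8) from hy)
  have h2 := abs_le.1 (show |u z - c| ≤ 2 * (ε / 8) from hz)
  rw [Real.dist_eq, abs_lt]
  constructor <;> linarith [h1.1, h1.2, h2.1, h2.2]

/-- The potential of `|∇u|^p` is infinite at each essential discontinuity of a weakly monotone
function. -/
theorem lintegral_mul_rieszKernel_eq_top (hn : 2 ≤ n) {p : ℝ} (hp : (n : ℝ) - 1 < p)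
    {σ : ℝ → ℝ} (hσcont : ContinuousOn σ (Ici 0))
    (hdiv : ∀ c : ℝ, 0 < c → ∫⁻ t in Ioi c, (ENNReal.ofReal (t * σ t))⁻¹ = ∞)
    (hug : IsWeakGradOn Ω u g) (hgm : Measurable g) (hmon : WeaklyMonotone Ω u)
    {x : Euc n} {R : ℝ} (hR0 : 0 < R) (hR : closedBall x R ⊆ Ω)
    (hgp : ∫⁻ y in closedBall x R, ‖g y‖ₑ ^ p ≠ ∞) (hx : x ∈ essDiscontinuitySet u) :
    ∫⁻ y in closedBall x R,
      ‖g y‖ₑ ^ p * rieszKernel (fun t => ENNReal.ofReal (σ t * t ^ p)) x y = ∞ := by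
  obtain ⟨C, hC, hosc⟩ := exists_ae_osc_ball hn hp
  obtain ⟨δ, hδ, hbad⟩ := exists_forall_not_ae_of_mem_essDiscontinuitySet hx
  have hn0 : n ≠ 0 := by omega
  have hp0 : 0 < p := by
    have : (2 : ℝ) ≤ n := by exact_mod_cast hn
    linarith
  set R' := R / 2
  have hRR : R' < R := half_lt_self hR0
  have hR'0 : 0 < R' := half_pos hR0
  set τ : ℝ → ℝ := fun t => σ (max t 0)
  have hτc : Continuous τ := hσcont.comp_continuous (by fun_prop) fun t => mem_Ici.2 (le_max_right t 0)
  have hτ : ∀ t, 0 ≤ t → τ t = σ t := fun t ht => by simp only [τ, max_eq_left ht]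
  set K : ℝ → ℝ≥0∞ := fun r =>
    (ENNReal.ofReal (r ^ n) * ENNReal.ofReal (τ (1 / r) * (1 / r) ^ p))⁻¹
  have hKm : Measurable K := by
    have := hτc.measurable
    fun_prop
  set G : Euc n → ℝ≥0∞ := fun y => ‖g y‖ₑ ^ p
  have hGm : Measurable G := hgm.enorm.pow_const p
  set F : Euc n → ℝ≥0∞ := (ball 0 R').indicator fun y => G (x + y) * K ‖y‖
  have hGm' : Measurable fun y => G (x + y) := hGm.comp (measurable_const_add x)
  have hFm : Measurable F := (hGm'.mul (hKm.comp measurable_norm)).indicator measurableSet_ball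
  have hle : ∫⁻ y, F y ≤ ∫⁻ y in closedBall x R,
      ‖g y‖ₑ ^ p * rieszKernel (fun t => ENNReal.ofReal (σ t * t ^ p)) x y := by
    rw [← lintegral_indicator measurableSet_closedBall]
    conv_rhs => rw [← lintegral_add_left_eq_self _ x]
    refine lintegral_mono fun y => ?_
    by_cases hy : y ∈ ball (0 : Euc n) R'
    · have hy' : x + y ∈ closedBall x R := by
        rw [mem_closedBall, dist_self_add_left]
        exact (mem_ball_zero_iff.1 hy).le.trans hRR.le
      simp only [F]
      rw [indicator_of_mem hy, indicator_of_mem hy', rieszKernel]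
      simp only [K, G, sub_add_cancel_left, norm_neg, hτ _ (one_div_nonneg.2 (norm_nonneg y))]
      exact le_rfl
    · simp only [F, indicator_of_notMem hy]
      exact zero_le
  refine top_le_iff.1 (le_trans ?_ hle)
  rw [lintegral_polar hn0 hFm]
  set κ : ℝ≥0∞ := ENNReal.ofReal δ ^ p / C ^ p
  have hκ : κ ≠ 0 := (ENNReal.div_pos (ENNReal.rpow_pos (by simpa using hδ) ofReal_ne_top).ne'
    (ENNReal.rpow_ne_top_of_nonneg hp0.le hC)).ne'
  have hlow : κ * ∫⁻ r in Ioo 0 R'⁻¹⁻¹, (ENNReal.ofReal (r * σ (1 / r)))⁻¹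
      ≤ ∫⁻ r in Ioi 0, ENNReal.ofReal (r ^ (n - 1)) * sphereInt F r := by
    rw [inv_inv]
    have hsub : Ioo 0 R' ⊆ Ioi 0 := Ioo_subset_Ioi_self
    refine (lintegral_const_mul_le _ _).trans (le_trans ?_ (lintegral_mono_set hsub))
    refine lintegral_mono_ae ?_
    filter_upwards [ae_restrict_of_ae_restrict_of_subset hsub
      (hosc Ω u g hug hgm hmon x R R' hR hRR hgp), ae_restrict_mem measurableSet_Ioo] with r hr hrI
    have hS : ENNReal.ofReal δ ≤
        C * ENNReal.ofReal r * sphereInt (fun y => G (x + y)) r ^ (1 / p) := by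
      by_contra! hlt
      obtain ⟨c, hc⟩ := hr hrI.2 δ hδ hlt
      exact hbad r hrI.1 c hc
    have hS' : κ ≤ ENNReal.ofReal r ^ p * sphereInt (fun y => G (x + y)) r := by
      refine ENNReal.div_le_of_le_mul' ?_
      refine (ENNReal.rpow_le_rpow hS hp0.le).trans (le_of_eq ?_)
      rw [ENNReal.mul_rpow_of_nonneg _ _ hp0.le, ENNReal.mul_rpow_of_nonneg _ _ hp0.le,
        ← ENNReal.rpow_mul, one_div_mul_cancel hp0.ne', ENNReal.rpow_one, mul_assoc]
    have hFr : sphereInt F r = K r * sphereInt (fun y => G (x + y)) r := by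
      rw [← sphereInt_const_mul hGm']
      refine lintegral_congr fun θ => ?_
      have hnorm : ‖r • (θ : Euc n)‖ = r := by
        rw [norm_smul, norm_eq_of_mem_sphere, mul_one, Real.norm_of_nonneg hrI.1.le]
      have hmem : r • (θ : Euc n) ∈ ball (0 : Euc n) R' := by
        rw [mem_ball_zero_iff, hnorm]
        exact hrI.2
      simp only [F]
      rw [indicator_of_mem hmem, hnorm, mul_comm]
    calc κ * (ENNReal.ofReal (r * σ (1 / r)))⁻¹
        ≤ ENNReal.ofReal r ^ p * sphereInt (fun y => G (x + y)) r
          * (ENNReal.ofReal (r * σ (1 / r)))⁻¹ := by gcongr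
      _ = ENNReal.ofReal r ^ p * (ENNReal.ofReal (r * σ (1 / r)))⁻¹
          * sphereInt (fun y => G (x + y)) r := by ring
      _ = ENNReal.ofReal (r ^ (n - 1)) * sphereInt F r := by
        rw [← ofReal_mul_kernel hn0 hrI.1, hFr, mul_assoc]
        simp only [K, hτ _ (one_div_nonneg.2 hrI.1.le)]
  rw [lintegral_Ioo_inv_eq (inv_pos.2 hR'0), hdiv _ (inv_pos.2 hR'0),
    ENNReal.mul_top hκ] at hlow
  exact hlow

end Potential

section Capacity

variable {n : ℕ} {Ω : Set (Euc n)} {u : Euc n → ℝ} {g : Euc n → Euc n}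

lemma capPsi_eq_zero_of_rieszPot_eq_top {Ψ : ℝ → ℝ≥0∞} {S : Set (Euc n)} {f : Euc n → ℝ≥0∞}
    (hf : Measurable f) (hfi : ∫⁻ x, f x ≠ ∞) (hS : ∀ x ∈ S, rieszPot Ψ f x = ∞) :
    capPsi Ψ S = 0 := by
  refine nonpos_iff_eq_zero.1 (le_of_forall_gt fun ε hε => ?_)
  obtain ⟨c, hc0, hc⟩ := ENNReal.exists_pos_mul_lt hfi hε.ne'
  refine lt_of_le_of_lt (iInf₂_le_of_le (fun x => c * f x) (hf.const_mul c)
    (iInf_le_of_le (fun x hx => ?_) (lintegral_const_mul c hf).le)) hc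
  have h : c * rieszPot Ψ f x ≤ rieszPot Ψ (fun x => c * f x) x := by
    simp only [rieszPot, mul_assoc]
    exact lintegral_const_mul_le _ _
  rw [hS x hx, ENNReal.mul_top hc0.ne'] at h
  exact le_top.trans h

lemma capPsi_eq_zero_of_locally {Ψ : ℝ → ℝ≥0∞} {S : Set (Euc n)} {G : Euc n → ℝ≥0∞}
    (hG : Measurable G) (h : ∀ x ∈ S, ∃ R, 0 < R ∧ ∫⁻ y in ball x R, G y ≠ ∞ ∧
      ∀ y ∈ ball x R ∩ S, ∫⁻ z in ball x R, G z * rieszKernel Ψ y z = ∞) :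
    capPsi Ψ S = 0 := by
  choose! R hR0 hRi hR using h
  obtain ⟨t, htS, htc, hcov⟩ := TopologicalSpace.countable_cover_nhdsWithin
    (f := fun x => ball x (R x)) (s := S)
    fun x hx => mem_nhdsWithin_of_mem_nhds (ball_mem_nhds x (hR0 x hx))
  have : Countable t := htc.to_subtype
  obtain ⟨ε, hε0, hε⟩ := ENNReal.exists_pos_sum_of_countable' one_ne_zero t
  set I : t → ℝ≥0∞ := fun i => ∫⁻ y in ball (i : Euc n) (R i), G y
  set c : t → ℝ≥0∞ := fun i => ε i / (1 + I i)
  have hI : ∀ i : t, 1 + I i ≠ ∞ := fun i => add_ne_top.2 ⟨one_ne_top, hRi i (htS i.2)⟩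
  have hc : ∀ i, c i ≠ 0 := fun i => (ENNReal.div_pos (hε0 i).ne' (hI i)).ne'
  have hm : ∀ i : t, Measurable ((ball (i : Euc n) (R i)).indicator G) := fun i =>
    hG.indicator measurableSet_ball
  refine capPsi_eq_zero_of_rieszPot_eq_top
    (f := fun y => ∑' i : t, c i * (ball (i : Euc n) (R i)).indicator G y)
    (Measurable.tsum fun i => (hm i).const_mul _) ?_ fun x hx => ?_
  · rw [lintegral_tsum fun i => ((hm i).const_mul _).aemeasurable]
    refine ne_top_of_le_ne_top one_ne_top (le_trans (ENNReal.tsum_le_tsum fun i => ?_) hε.le)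
    rw [lintegral_const_mul _ (hm i), lintegral_indicator measurableSet_ball]
    refine (mul_le_mul_right (le_add_self : I i ≤ 1 + I i) (c i)).trans (le_of_eq ?_)
    exact ENNReal.div_mul_cancel (by simp) (hI i)
  · obtain ⟨i, hi, hxi⟩ := mem_iUnion₂.1 (hcov hx)
    have h1 : ∞ ≤ c ⟨i, hi⟩ * ∫⁻ z in ball i (R i), G z * rieszKernel Ψ x z := by
      rw [hR i (htS hi) x ⟨hxi, hx⟩, ENNReal.mul_top (hc _)]
    refine top_le_iff.1 (h1.trans ?_)
    rw [← lintegral_indicator measurableSet_ball]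
    refine (lintegral_const_mul_le _ _).trans (lintegral_mono fun z => ?_)
    refine le_trans (le_of_eq ?_) (mul_le_mul_left (ENNReal.le_tsum
      (f := fun j : t => c j * (ball (j : Euc n) (R j)).indicator G z) ⟨i, hi⟩) _)
    by_cases hz : z ∈ ball i (R i) <;> simp [hz, mul_assoc]

lemma exists_nhds_ae_of_eventually_nhdsAE {x : Euc n} {P : Euc n → Prop}
    (h : ∀ᶠ y in nhdsAE x, P y) : ∃ W ∈ 𝓝 x, ∀ᵐ y, y ∈ W → P y := by
  obtain ⟨W, hW, t, ht, hsub⟩ := Filter.mem_inf_iff_superset.1 h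
  exact ⟨W, hW, mem_of_superset ht fun y hy hyW => hsub ⟨hyW, hy⟩⟩

lemma eventually_eventually_nhdsAE {x : Euc n} {P : Euc n → Prop}
    (h : ∀ᶠ y in nhdsAE x, P y) : ∀ᶠ z in 𝓝 x, ∀ᶠ y in nhdsAE z, P y := by
  obtain ⟨W, hW, hP⟩ := exists_nhds_ae_of_eventually_nhdsAE h
  filter_upwards [eventually_mem_nhds_iff.2 hW] with z hz
  rw [nhdsAE]
  filter_upwards [mem_inf_of_left hz, mem_inf_of_right hP] with y h1 h2
  exact h2 h1

lemma volume_eq_zero_of_eventually_notMem {T : Set (Euc n)}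
    (h : ∀ x ∈ T, ∀ᶠ y in nhdsAE x, y ∉ T) : volume T = 0 := by
  refine measure_null_of_locally_null _ fun x hx => ?_
  obtain ⟨W, hW, hP⟩ := exists_nhds_ae_of_eventually_nhdsAE (h x hx)
  refine ⟨W ∩ T, inter_mem (mem_nhdsWithin_of_mem_nhds hW) self_mem_nhdsWithin, ?_⟩
  refine measure_mono_null (fun y hy => ?_) (ae_iff.1 hP)
  exact fun hn => hn hy.1 hy.2

/-- A function agrees almost everywhere with one which is continuous away from the essential
discontinuities. -/
theorem exists_ae_eq_continuousOn_compl (u : Euc n → ℝ) :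
    ∃ v : Euc n → ℝ, v =ᵐ[volume] u ∧ ContinuousOn v (essDiscontinuitySet u)ᶜ := by
  classical
  set v : Euc n → ℝ := fun x => if x ∈ essDiscontinuitySet u then u x else lim (map u (nhdsAE x))
  have hv : ∀ x ∉ essDiscontinuitySet u, Tendsto u (nhdsAE x) (𝓝 (v x)) := fun x hx => by
    simp only [v, if_neg hx]
    exact (not_not.1 hx : Cauchy (map u (nhdsAE x))).le_nhds_lim
  refine ⟨v, ?_, fun x hx => ?_⟩
  · have hlt : ∀ q : ℚ, volume {x | x ∉ essDiscontinuitySet u ∧ u x < q ∧ q < v x} = 0 := fun q =>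
      volume_eq_zero_of_eventually_notMem fun x hx => by
        filter_upwards [(hv x hx.1).eventually_const_lt hx.2.2] with y hy hyT
        exact lt_asymm hy hyT.2.1
    have hgt : ∀ q : ℚ, volume {x | x ∉ essDiscontinuitySet u ∧ v x < q ∧ q < u x} = 0 := fun q =>
      volume_eq_zero_of_eventually_notMem fun x hx => by
        filter_upwards [(hv x hx.1).eventually_lt_const hx.2.1] with y hy hyT
        exact lt_asymm hy hyT.2.2
    filter_upwards [ae_all_iff.2 fun q => measure_eq_zero_iff_ae_notMem.1 (hlt q),
      ae_all_iff.2 fun q => measure_eq_zero_iff_ae_notMem.1 (hgt q)] with x h1 h2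
    by_cases hx : x ∈ essDiscontinuitySet u
    · simp only [v, if_pos hx]
    · by_contra hne
      rcases lt_or_gt_of_ne hne with h | h
      · obtain ⟨q, hq1, hq2⟩ := exists_rat_btwn h
        exact h2 q ⟨hx, hq1, hq2⟩
      · obtain ⟨q, hq1, hq2⟩ := exists_rat_btwn h
        exact h1 q ⟨hx, hq1, hq2⟩
  · refine Metric.tendsto_nhds.2 fun ε hε => ?_
    have h := (hv x hx).eventually (closedBall_mem_nhds (v x) (half_pos hε))
    filter_upwards [mem_nhdsWithin_of_mem_nhds (eventually_eventually_nhdsAE h),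
      self_mem_nhdsWithin] with z hz hzS
    exact lt_of_le_of_lt (mem_closedBall.1 (isClosed_closedBall.mem_of_tendsto (hv z hzS) hz))
      (half_lt_self hε)

/-- The conclusion for a single continuous weight with divergent integral. -/
theorem exists_continuousOn_off_capPsi_zero (hn : 2 ≤ n) (hΩ : IsOpen Ω) {p : ℝ}
    (hp : (n : ℝ) - 1 < p) {σ : ℝ → ℝ} (hσcont : ContinuousOn σ (Ici 0))
    (hdiv : ∀ c : ℝ, 0 < c → ∫⁻ t in Ioi c, (ENNReal.ofReal (t * σ t))⁻¹ = ∞)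
    (hu : MemW1Aloc (fun t => ENNReal.ofReal (t ^ p)) Ω u g) (hmon : WeaklyMonotone Ω u) :
    ∃ v : Euc n → ℝ, (∀ᵐ x ∂volume.restrict Ω, v x = u x) ∧
      ∃ S : Set (Euc n), capPsi (fun t => ENNReal.ofReal (σ t * t ^ p)) S = 0 ∧
        ContinuousOn v (Ω \ S) := by
  have hp0 : 0 < p := by
    have : (2 : ℝ) ≤ n := by exact_mod_cast hn
    linarith
  obtain ⟨h, hm, hle, hug⟩ := exists_measurable_weakGrad hΩ hu.1
  obtain ⟨v, hv, hvc⟩ := exists_ae_eq_continuousOn_compl u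
  refine ⟨v, ae_restrict_of_ae hv, Ω ∩ essDiscontinuitySet u, ?_, hvc.mono fun x hx hxS =>
    hx.2 ⟨hx.1, hxS⟩⟩
  have hfin : ∀ x r, closedBall x r ⊆ Ω → ∫⁻ y in ball x r, ‖h y‖ₑ ^ p ≠ ∞ := by
    intro x r hr
    have hcl : closure (ball x r) ⊆ closedBall x r := closure_ball_subset_closedBall
    obtain ⟨l, hl, hlt⟩ := (hu.2 (ball x r) isOpen_ball
      ((isCompact_closedBall x r).of_isClosed_subset isClosed_closure hcl) (hcl.trans hr)).2
    have hbound : ∫⁻ y in ball x r, ‖h y‖ₑ ^ p ≤ ∫⁻ y in ball x r,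
        ENNReal.ofReal l ^ p * ENNReal.ofReal ((|‖g y‖| / l) ^ p) := by
      refine lintegral_mono_ae ?_
      filter_upwards [ae_restrict_of_ae_restrict_of_subset (ball_subset_closedBall.trans hr) hle]
        with y hy
      rw [← ENNReal.ofReal_rpow_of_nonneg (by positivity) hp0.le,
        ← ENNReal.mul_rpow_of_nonneg _ _ hp0.le, ← ENNReal.ofReal_mul hl.le, abs_norm,
        mul_div_cancel₀ _ hl.ne', ← ofReal_norm]
      gcongr
    refine ne_top_of_le_ne_top ?_ hbound
    rw [lintegral_const_mul' _ _ (by simp [hp0.le])]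
    exact mul_ne_top (by simp [hp0.le]) hlt.ne
  refine capPsi_eq_zero_of_locally (hm.enorm.pow_const p) fun x hx => ?_
  obtain ⟨R, hR0, hR⟩ := Metric.nhds_basis_closedBall.mem_iff.1 (hΩ.mem_nhds hx.1)
  refine ⟨R, hR0, hfin x R hR, fun y hy => ?_⟩
  obtain ⟨r, hr0, hr⟩ := Metric.nhds_basis_closedBall.mem_iff.1 (isOpen_ball.mem_nhds hy.1)
  refine top_le_iff.1 (le_trans (le_of_eq ?_) (lintegral_mono_set hr))
  exact (lintegral_mul_rieszKernel_eq_top hn hp hσcont hdiv hug hm hmon hr0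
    ((hr.trans ball_subset_closedBall).trans hR)
    (ne_top_of_le_ne_top (hfin x R hR) (lintegral_mono_set hr)) hy.2.2).symm

lemma lintegral_Ioi_inv_mul_log_eq_top {c : ℝ} (hc : 0 < c) :
    ∫⁻ t in Ioi c, (ENNReal.ofReal (t * Real.log (1 + t)))⁻¹ = ∞ := by
  by_contra hne
  have hfint : IntegrableOn (fun t => (t * Real.log (1 + t))⁻¹) (Ioi c) := by
    have hm : Measurable fun t : ℝ => (t * Real.log (1 + t))⁻¹ := by fun_prop
    refine ⟨hm.aestronglyMeasurable, ?_⟩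
    rw [HasFiniteIntegral, lt_top_iff_ne_top]
    refine (lintegral_congr_ae ?_).trans_ne hne
    filter_upwards [ae_restrict_mem measurableSet_Ioi] with t ht
    have ht0 : 0 < t := hc.trans ht
    have hpos : 0 < t * Real.log (1 + t) := mul_pos ht0 (Real.log_pos (by linarith))
    rw [Real.enorm_of_nonneg (inv_nonneg.2 hpos.le), ENNReal.ofReal_inv_of_pos hpos]
  have hd : ∀ t : ℝ, 0 < t → HasDerivAt (fun t => Real.log (Real.log (1 + t)))
      (1 / (1 + t) / Real.log (1 + t)) t := fun t ht =>
    (((hasDerivAt_id t).const_add 1).log (by simp; linarith)).log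
      (Real.log_pos (by simpa using ht)).ne'
  refine not_integrableOn_of_tendsto_norm_atTop_of_deriv_isBigO_filter (l := atTop)
    (f := fun t => Real.log (Real.log (1 + t))) (Ioi_mem_atTop c) ?_ ?_ ?_ hfint
  · filter_upwards [eventually_gt_atTop 0] with t ht
    exact (hd t ht).differentiableAt
  · exact tendsto_norm_atTop_atTop.comp (Real.tendsto_log_atTop.comp
      (Real.tendsto_log_atTop.comp (tendsto_atTop_add_const_left _ 1 tendsto_id)))
  · refine Asymptotics.IsBigO.of_bound 1 ?_
    filter_upwards [eventually_gt_atTop 0] with t ht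
    have hl : 0 < Real.log (1 + t) := Real.log_pos (by linarith)
    rw [(hd t ht).deriv, one_mul, div_div, one_div, norm_inv, norm_inv,
      Real.norm_of_nonneg (by positivity), Real.norm_of_nonneg (by positivity)]
    gcongr
    linarith

end Capacity

theorem weaklyMonotone_W1p_continuous_off_capacity_zero {n : ℕ} (hn : 2 ≤ n)
    (Ω : Set (Euc n)) (hΩ : IsOpen Ω)
    (p : ℝ) (hp1 : (n : ℝ) - 1 < p) (hp2 : p < n)
    (σ : ℝ → ℝ) (hσcont : ContinuousOn σ (Ici 0))
    (hσnonneg : ∀ t ∈ Ici (0 : ℝ), 0 ≤ σ t)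
    (hdiv : ∀ c : ℝ, 0 < c → ∫⁻ t in Ioi c, (ENNReal.ofReal (t * σ t))⁻¹ = ∞)
    (u : Euc n → ℝ) (g : Euc n → Euc n)
    (hu : MemW1Aloc (fun t => ENNReal.ofReal (t ^ p)) Ω u g)
    (hmon : WeaklyMonotone Ω u) :
    (∃ v : Euc n → ℝ, (∀ᵐ x ∂volume.restrict Ω, v x = u x) ∧
        ∃ S : Set (Euc n),
          capPsi (fun t => ENNReal.ofReal (σ t * t ^ p)) S = 0 ∧
          ContinuousOn v (Ω \ S)) ∧
      ∃ v : Euc n → ℝ, (∀ᵐ x ∂volume.restrict Ω, v x = u x) ∧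
        ∃ S : Set (Euc n),
          capPsi (fun t => ENNReal.ofReal (Real.log (1 + t) * t ^ p)) S = 0 ∧
          ContinuousOn v (Ω \ S) := by
  exact ⟨exists_continuousOn_off_capPsi_zero hn hΩ hp1 hσcont hdiv hu hmon,
    exists_continuousOn_off_capPsi_zero hn hΩ hp1
      (ContinuousOn.log (by fun_prop) fun t ht => by
        have : (0 : ℝ) ≤ t := ht
        positivity)
      (fun _ => lintegral_Ioi_inv_mul_log_eq_top) hu hmon⟩
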